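/- Suppose I ⊆ K{y_1,…,y_n} is a pure binomial σ-ideal. Then there exist l ∈ ℕ, indices p_1,…,p_l ∈ {1,…,n} and natural numbers a_1,…,a_l such that ⟨I⟩_r = (⟨I⟩_r : 𝔪) ∩ ⟨I ∪ {y_{p_1}^{x^{a_1}}}⟩_r ∩ ⋯ ∩ ⟨I ∪ {y_{p_l}^{x^{a_l}}}⟩_r. -/

import Mathlib

open Polynomial

section SigmaRing

variable {R : Type*} [CommRing R]

/-- A σ-ideal: an ideal closed under the difference operator σ. -/
def IsSigmaIdeal (σ : R →+* R) (I : Ideal R) : Prop := ∀ a ∈ I, σ a ∈ I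

/-- A σ-ideal is well-mixed if `a * b ∈ I` implies `a * σ b ∈ I`. -/
def IsWellMixed (σ : R →+* R) (I : Ideal R) : Prop := ∀ a b : R, a * b ∈ I → a * σ b ∈ I

/-- `[F]`, the smallest σ-ideal containing `F`. -/
def sigmaIdealGen (σ : R →+* R) (F : Set R) : Ideal R :=
  sInf {I : Ideal R | F ⊆ I ∧ IsSigmaIdeal σ I}

/-- `⟨F⟩`, the smallest well-mixed σ-ideal containing `F` (well-mixed closure). -/
def wmClosure (σ : R →+* R) (F : Set R) : Ideal R :=
  sInf {I : Ideal R | F ⊆ I ∧ IsSigmaIdeal σ I ∧ IsWellMixed σ I}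

/-- `⟨F⟩_r`, the smallest radical well-mixed σ-ideal containing `F`. -/
def rwmClosure (σ : R →+* R) (F : Set R) : Ideal R :=
  sInf {I : Ideal R | F ⊆ I ∧ IsSigmaIdeal σ I ∧ IsWellMixed σ I ∧ I.IsRadical}

/-- Symbolic exponent: for `p = Σ c_i x^i ∈ ℕ[x]`, `a^p = Π (σ^i a)^(c_i)`. -/
noncomputable def sexp (σ : R →+* R) (a : R) (p : Polynomial ℕ) : R :=
  ∏ i ∈ Finset.range (p.natDegree + 1), ((⇑σ)^[i] a) ^ (p.coeff i)

/-- `I` is finitely generated as a radical well-mixed σ-ideal. -/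
def FinGenAsRWM (σ : R →+* R) (I : Ideal R) : Prop :=
  ∃ G : Set R, G.Finite ∧ G ⊆ (I : Set R) ∧ I = rwmClosure σ G

/-- σ-prime: a reflexive σ-ideal which is prime. -/
def IsSigmaPrime (σ : R →+* R) (I : Ideal R) : Prop :=
  IsSigmaIdeal σ I ∧ (∀ a : R, σ a ∈ I → a ∈ I) ∧ I.IsPrime

end SigmaRing

/-- The σ-polynomial ring `K{y_1,…,y_n}`: polynomials in variables `y_i^{x^j}`,
indexed by pairs `(i, j) ∈ Fin n × ℕ`. -/
abbrev DPoly (K : Type*) [Field K] (n : ℕ) := MvPolynomial (Fin n × ℕ) K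

section DPoly

variable {K : Type*} [Field K] {n : ℕ} (σK : K →+* K)

/-- The difference operator on `K{y_1,…,y_n}` extending `σK`, with `σ(y_i^{x^j}) = y_i^{x^{j+1}}`. -/
noncomputable def shift : DPoly K n →+* DPoly K n :=
  MvPolynomial.eval₂Hom ((MvPolynomial.C : K →+* DPoly K n).comp σK)
    (fun v => MvPolynomial.X (v.1, v.2 + 1))

/-- `y_i^p` for `p ∈ ℕ[x]`. -/
noncomputable def ypow (i : Fin n) (p : Polynomial ℕ) : DPoly K n :=
  sexp (shift σK) (MvPolynomial.X (i, 0)) p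

/-- `y_i^{x^a}`. -/
noncomputable def varPow (i : Fin n) (a : ℕ) : DPoly K n :=
  ypow σK i (Polynomial.X ^ a)

/-- The monomial `Y^f = Π y_i^{f_i}` for `f ∈ ℕ[x]^n`. -/
noncomputable def monom (f : Fin n → Polynomial ℕ) : DPoly K n :=
  ∏ i, ypow σK i (f i)

/-- A pure binomial `Y^f − Y^g`. -/
def IsPureBinomial (p : DPoly K n) : Prop :=
  ∃ f g : Fin n → Polynomial ℕ, p = monom σK f - monom σK g

/-- A binomial `a·Y^f + b·Y^g` with `a, b ∈ K^×`. -/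
def IsBinomial (p : DPoly K n) : Prop :=
  ∃ (a b : K) (f g : Fin n → Polynomial ℕ), a ≠ 0 ∧ b ≠ 0 ∧
    p = MvPolynomial.C a * monom σK f + MvPolynomial.C b * monom σK g

/-- A pure binomial σ-ideal: a σ-ideal generated by pure binomials. -/
def IsPureBinomialSigmaIdeal (I : Ideal (DPoly K n)) : Prop :=
  ∃ S : Set (DPoly K n), (∀ p ∈ S, IsPureBinomial σK p) ∧ I = sigmaIdealGen (shift σK) S

/-- Positive part of `f ∈ ℤ[x]`. -/
noncomputable def posPart (f : Polynomial ℤ) : Polynomial ℕ :=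
  f.sum fun i c => Polynomial.monomial i c.toNat

/-- Negative part of `f ∈ ℤ[x]`. -/
noncomputable def negPart (f : Polynomial ℤ) : Polynomial ℕ :=
  f.sum fun i c => Polynomial.monomial i (-c).toNat

/-- The lattice σ-ideal `I_L = [Y^{f_+} − Y^{f_−} : f ∈ L]` of a ℤ[x]-lattice `L ⊆ ℤ[x]^n`. -/
noncomputable def latticeIdeal (L : Submodule (Polynomial ℤ) (Fin n → Polynomial ℤ)) :
    Ideal (DPoly K n) :=
  sigmaIdealGen (shift σK)
    {p | ∃ f ∈ L, p = monom σK (fun i => posPart (f i)) - monom σK (fun i => negPart (f i))}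

end DPoly

/-- `𝔪`: the multiplicatively closed set generated by the variables `y_i^{x^j}`. -/
def mSet (K : Type*) [Field K] (n : ℕ) : Set (DPoly K n) :=
  (Submonoid.closure (Set.range fun v : Fin n × ℕ => (MvPolynomial.X v : DPoly K n)) : Set _)

/-- `I : 𝔪 = {p : M p ∈ I for some M ∈ 𝔪}`. -/
def colonM {K : Type*} [Field K] {n : ℕ} (I : Ideal (DPoly K n)) : Set (DPoly K n) :=
  {p | ∃ M ∈ mSet K n, M * p ∈ I}

section Tsec

variable {K : Type*} [Field K] {n t : ℕ} (σK : K →+* K)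

/-- The set `T^{a_1…a_t}_{j_1…j_t}` of monomials `Y^f` with `deg f_{j_i} < a_i`. -/
def Tset (j : Fin t → Fin n) (a : Fin t → ℕ) : Set (DPoly K n) :=
  {p | ∃ f : Fin n → Polynomial ℕ,
    (∀ i : Fin t, (f (j i)).degree < (a i : WithBot ℕ)) ∧ p = monom σK f}

/-- `I` is saturated with respect to `{y_{j_1}^{x^{a_1}},…,y_{j_t}^{x^{a_t}}}`. -/
def SaturatedWrt (j : Fin t → Fin n) (a : Fin t → ℕ) (I : Ideal (DPoly K n)) : Prop :=
  ∀ g M : DPoly K n, M ∈ Tset σK j a → M * g ∈ I → g ∈ I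

/-- `J : T = {g : M g ∈ J for some M ∈ T}`. -/
def colonT (j : Fin t → Fin n) (a : Fin t → ℕ) (J : Ideal (DPoly K n)) : Set (DPoly K n) :=
  {g | ∃ M ∈ Tset σK j a, M * g ∈ J}

/-- The `T`-saturated closure `N^{a_1…a_t}_{j_1…j_t}(I)`: the smallest saturated σ-ideal
containing `I`. -/
noncomputable def Nclosure (j : Fin t → Fin n) (a : Fin t → ℕ) (I : Ideal (DPoly K n)) :
    Ideal (DPoly K n) :=
  sInf {J : Ideal (DPoly K n) | I ≤ J ∧ IsSigmaIdeal (shift σK) J ∧ SaturatedWrt σK j a J}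

/-- The set of variables `{y_{j_1}^{x^{a_1}},…,y_{j_t}^{x^{a_t}}}`. -/
noncomputable def varSet (j : Fin t → Fin n) (a : Fin t → ℕ) : Set (DPoly K n) :=
  Set.range fun i => varPow σK (j i) (a i)

/-- `⟨I₀ ∪ {y_{j_1}^{x^{a_1}},…,y_{j_t}^{x^{a_t}}}⟩_r` is quasi-normal. -/
def QuasiNormal (j : Fin t → Fin n) (a : Fin t → ℕ) (I0 : Ideal (DPoly K n)) : Prop :=
  SaturatedWrt σK j a I0 ∧
  ∀ f g : Fin n → Polynomial ℕ, monom σK f - monom σK g ∈ I0 →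
    monom σK f ∈ sigmaIdealGen (shift σK) (varSet σK j a) →
    monom σK g ∈ sigmaIdealGen (shift σK) (varSet σK j a)

end Tsec

/-- The translate of a finitely supported function on the variables by `x^k`. -/
noncomputable def shiftBy {n : ℕ} {M : Type*} [AddCommMonoid M] (k : ℕ) :
    ((Fin n × ℕ) →₀ M) →+ ((Fin n × ℕ) →₀ M) :=
  Finsupp.mapDomain.addMonoidHom fun u => (u.1, u.2 + k)

section ShiftBy

variable {n : ℕ} {M : Type*} [AddCommMonoid M]

lemma shiftBy_def (k : ℕ) (f : (Fin n × ℕ) →₀ M) :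
    shiftBy k f = Finsupp.mapDomain (fun u : Fin n × ℕ => (u.1, u.2 + k)) f := rfl

lemma add_right_var_injective (k : ℕ) :
    Function.Injective fun u : Fin n × ℕ => (u.1, u.2 + k) := by
  rintro ⟨i, j⟩ ⟨i', j'⟩ h
  simpa using h

@[simp]
lemma shiftBy_apply_add (k : ℕ) (f : (Fin n × ℕ) →₀ M) (i : Fin n) (j : ℕ) :
    shiftBy k f (i, j + k) = f (i, j) :=
  Finsupp.mapDomain_apply (add_right_var_injective k) f (i, j)

lemma shiftBy_apply_of_le {k j : ℕ} (h : k ≤ j) (f : (Fin n × ℕ) →₀ M) (i : Fin n) :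
    shiftBy k f (i, j) = f (i, j - k) := by
  conv_lhs => rw [← Nat.sub_add_cancel h]
  exact shiftBy_apply_add k f i (j - k)

lemma exists_of_shiftBy_ne_zero {k : ℕ} {f : (Fin n × ℕ) →₀ M} {i : Fin n} {j : ℕ}
    (h : shiftBy k f (i, j) ≠ 0) : ∃ m, j = m + k ∧ f (i, m) ≠ 0 := by
  by_cases hk : k ≤ j
  · exact ⟨j - k, by omega, by rwa [shiftBy_apply_of_le hk] at h⟩
  · refine absurd (Finsupp.mapDomain_of_notMem_range _ _ ?_) h
    rintro ⟨⟨a, b⟩, hab⟩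
    simp only [Prod.mk.injEq] at hab
    omega

lemma shiftBy_shiftBy (a b : ℕ) (f : (Fin n × ℕ) →₀ M) :
    shiftBy a (shiftBy b f) = shiftBy (b + a) f := by
  simp only [shiftBy_def, ← Finsupp.mapDomain_comp]
  congr 1
  funext u
  simp [add_assoc]

@[simp]
lemma shiftBy_zero_left (f : (Fin n × ℕ) →₀ M) : shiftBy 0 f = f := by
  exact Finsupp.mapDomain_id (v := f)

end ShiftBy

/-- A linear order on the variables, given by an injective key, which is compatible with
the translation and for which the translation is increasing. -/
structure IsShiftOrder {n : ℕ} {O : Type*} [LinearOrder O] (κ : Fin n × ℕ → O) : Prop where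
  injective : Function.Injective κ
  lt_shift : ∀ i j, κ (i, j) < κ (i, j + 1)
  shift_lt_shift : ∀ i j i' j', κ (i, j) < κ (i', j') → κ (i, j + 1) < κ (i', j' + 1)

namespace IsShiftOrder

variable {n : ℕ} {O : Type*} [LinearOrder O] {κ : Fin n × ℕ → O}

lemma strictMono (h : IsShiftOrder κ) (i : Fin n) : StrictMono fun j => κ (i, j) :=
  strictMono_nat_of_lt_succ (h.lt_shift i)

lemma shift_le_shift (h : IsShiftOrder κ) (k : ℕ) {i i' : Fin n} {j j' : ℕ}
    (hle : κ (i, j) ≤ κ (i', j')) : κ (i, j + k) ≤ κ (i', j' + k) := by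
  rcases hle.eq_or_lt with he | hlt
  · have := h.injective he
    simp only [Prod.mk.injEq] at this
    rw [this.1, this.2]
  · refine le_of_lt ?_
    induction k with
    | zero => simpa using hlt
    | succ k ih => exact h.shift_lt_shift _ _ _ _ ih

lemma wellFounded (h : IsShiftOrder κ) : WellFounded fun u v => κ u < κ v := by
  classical
  rw [WellFounded.wellFounded_iff_has_min]
  rintro T ⟨⟨i₀, j₀⟩, h₀⟩
  let C : Set (Fin n × ℕ) := (fun i => (i, sInf {j | (i, j) ∈ T})) '' {i | ∃ j, (i, j) ∈ T}
  obtain ⟨m, ⟨i, hi, rfl⟩, hmin⟩ := Set.exists_min_image C κ ((Set.toFinite _).image _)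
    ⟨_, i₀, ⟨j₀, h₀⟩, rfl⟩
  refine ⟨_, Nat.sInf_mem (s := {j | (i, j) ∈ T}) hi, ?_⟩
  rintro ⟨i', j'⟩ hT hlt
  have h1 := hmin _ ⟨i', ⟨j', hT⟩, rfl⟩
  have h2 := (h.strictMono i').monotone (Nat.sInf_le (s := {j | (i', j) ∈ T}) hT)
  exact absurd (h1.trans h2) (not_le.mpr hlt)

/-- Elements `g v` with leading variable at most `v` whose leading coefficients divide
all leading coefficients occurring in `Λ`; from some point on they are translates. -/
lemma exists_basis (h : IsShiftOrder κ) (Λ : AddSubgroup ((Fin n × ℕ) →₀ ℤ))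
    (hΛ : ∀ k, ∀ f ∈ Λ, shiftBy k f ∈ Λ) :
    ∃ (J : Fin n → ℕ) (g : Fin n × ℕ → ((Fin n × ℕ) →₀ ℤ)),
      (∀ v, g v ∈ Λ) ∧ (∀ v, ∀ u ∈ (g v).support, κ u ≤ κ v) ∧
      (∀ v, ∀ f ∈ Λ, (∀ u ∈ f.support, κ u ≤ κ v) → g v v ∣ f v) ∧
      (∀ i j, g (i, j) = shiftBy (j - min j (J i)) (g (i, min j (J i)))) := by
  classical
  let low (v : Fin n × ℕ) : AddSubgroup ((Fin n × ℕ) →₀ ℤ) :=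
    { carrier := {f | f ∈ Λ ∧ ∀ u, κ v < κ u → f u = 0}
      zero_mem' := ⟨Λ.zero_mem, fun _ _ => rfl⟩
      add_mem' := fun ha hb => ⟨Λ.add_mem ha.1 hb.1, fun u hu => by
        simp [ha.2 u hu, hb.2 u hu]⟩
      neg_mem' := fun ha => ⟨Λ.neg_mem ha.1, fun u hu => by simp [ha.2 u hu]⟩ }
  have low_iff : ∀ v f, f ∈ low v ↔ f ∈ Λ ∧ ∀ u ∈ f.support, κ u ≤ κ v := by
    intro v f
    refine and_congr_right fun _ => forall_congr' fun u => ?_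
    rw [Finsupp.mem_support_iff, ← not_lt]
    tauto
  let C (v : Fin n × ℕ) : Submodule ℤ ℤ :=
    AddSubgroup.toIntSubmodule ((low v).map (Finsupp.applyAddHom v))
  have C_iff : ∀ v a, a ∈ C v ↔ ∃ f ∈ low v, f v = a := fun v a => Iff.rfl
  have shift_low : ∀ i j k f, f ∈ low (i, j) → shiftBy k f ∈ low (i, j + k) := by
    intro i j k f hf
    rw [low_iff] at hf ⊢
    refine ⟨hΛ k f hf.1, ?_⟩
    rintro ⟨i', j'⟩ hu
    obtain ⟨m, rfl, hm⟩ := exists_of_shiftBy_ne_zero (Finsupp.mem_support_iff.mp hu)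
    exact h.shift_le_shift k (hf.2 _ (Finsupp.mem_support_iff.mpr hm))
  have C_mono : ∀ i, Monotone fun j => C (i, j) := by
    intro i
    refine monotone_nat_of_le_succ fun j a ha => ?_
    obtain ⟨f, hf, rfl⟩ := (C_iff _ _).mp ha
    exact (C_iff _ _).mpr ⟨_, shift_low i j 1 f hf, shiftBy_apply_add 1 f i j⟩
  have stab : ∀ i, ∃ J, ∀ m, J ≤ m → C (i, J) = C (i, m) := fun i =>
    monotone_stabilizes_iff_noetherian.mpr (inferInstance : IsNoetherian ℤ ℤ) ⟨_, C_mono i⟩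
  choose J hJ using stab
  have gen : ∀ v, ∃ f ∈ low v, ∀ a ∈ C v, f v ∣ a := by
    intro v
    obtain ⟨f, hf, hfv⟩ := (C_iff v _).mp (Submodule.IsPrincipal.generator_mem (C v))
    refine ⟨f, hf, fun a ha => ?_⟩
    rw [hfv]
    obtain ⟨c, rfl⟩ := (Submodule.IsPrincipal.mem_iff_eq_smul_generator (C v)).mp ha
    exact ⟨c, by simp [mul_comm]⟩
  choose g₀ hg₀ hdvd using gen
  let g : Fin n × ℕ → ((Fin n × ℕ) →₀ ℤ) := fun v =>
    shiftBy (v.2 - min v.2 (J v.1)) (g₀ (v.1, min v.2 (J v.1)))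
  have hg : ∀ v, g v ∈ low v := by
    rintro ⟨i, j⟩
    have := shift_low i (min j (J i)) (j - min j (J i)) _ (hg₀ _)
    rwa [Nat.add_sub_cancel' (min_le_left _ _)] at this
  refine ⟨J, g, fun v => (hg v).1, fun v => ((low_iff _ _).mp (hg v)).2, ?_, ?_⟩
  · rintro ⟨i, j⟩ f hf hu
    have hC : C (i, j) = C (i, min j (J i)) := by
      rcases le_total j (J i) with hle | hle
      · rw [min_eq_left hle]
      · rw [min_eq_right hle, hJ i j hle]
    have hv : g (i, j) (i, j) = g₀ (i, min j (J i)) (i, min j (J i)) := by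
      simp only [g]
      rw [shiftBy_apply_of_le (Nat.sub_le _ _), Nat.sub_sub_self (min_le_left _ _)]
    rw [hv]
    exact hdvd _ _ (hC ▸ (C_iff _ _).mpr ⟨f, (low_iff _ _).mpr ⟨hf, hu⟩, rfl⟩)
  · intro i j
    simp [g]

/-- Division by a family with `g v` supported below `v`. -/
lemma exists_reduced {O' : Type*} [LinearOrder O'] {κ' : Fin n × ℕ → O'} (h : IsShiftOrder κ')
    (g : Fin n × ℕ → ((Fin n × ℕ) →₀ ℤ)) (hg : ∀ v, ∀ u ∈ (g v).support, κ' u ≤ κ' v)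
    (D : Set (Fin n × ℕ)) (hD : ∀ u v, κ' u ≤ κ' v → v ∈ D → u ∈ D)
    (f : (Fin n × ℕ) →₀ ℤ) (hf : ∀ u ∈ f.support, u ∈ D) :
    ∃ r, f - r ∈ AddSubgroup.closure (g '' D) ∧ ∀ v, r v % g v v = r v := by
  classical
  have key : ∀ w, ∀ f : (Fin n × ℕ) →₀ ℤ, (∀ u ∈ f.support, u ∈ D ∧ κ' u ≤ κ' w) →
      ∃ r : (Fin n × ℕ) →₀ ℤ, f - r ∈ AddSubgroup.closure (g '' D) ∧
        (∀ v, r v % g v v = r v) ∧ ∀ u ∈ r.support, κ' u ≤ κ' w := by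
    intro w
    induction w using h.wellFounded.induction with
    | _ w ih =>
    have below : ∀ f : (Fin n × ℕ) →₀ ℤ, (∀ u ∈ f.support, u ∈ D ∧ κ' u < κ' w) →
        ∃ r : (Fin n × ℕ) →₀ ℤ, f - r ∈ AddSubgroup.closure (g '' D) ∧
          (∀ v, r v % g v v = r v) ∧ ∀ u ∈ r.support, κ' u < κ' w := by
      intro f hf
      rcases f.support.eq_empty_or_nonempty with he | hne
      · exact ⟨0, by simp [Finsupp.support_eq_empty.mp he], by simp, by simp⟩
      · obtain ⟨m, hm, hmax⟩ := Finset.exists_max_image f.support κ' hne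
        obtain ⟨r, h1, h2, h3⟩ := ih m (hf m hm).2 f fun u hu => ⟨(hf u hu).1, hmax u hu⟩
        exact ⟨r, h1, h2, fun u hu => (h3 u hu).trans_lt (hf m hm).2⟩
    intro f hf
    by_cases hw : w ∈ D
    swap
    · obtain ⟨r, h1, h2, h3⟩ := below f fun u hu => ⟨(hf u hu).1,
        lt_of_le_of_ne (hf u hu).2 fun he => hw (h.injective he ▸ (hf u hu).1)⟩
      exact ⟨r, h1, h2, fun u hu => (h3 u hu).le⟩
    let f' := f - (f w / g w w) • g w - Finsupp.single w (f w % g w w)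
    have hf'w : f' w = 0 := by
      simp only [f', Finsupp.sub_apply, Finsupp.smul_apply, Finsupp.single_eq_same, smul_eq_mul]
      linarith [Int.mul_ediv_add_emod (f w) (g w w), mul_comm (f w / g w w) (g w w)]
    have hf' : ∀ u ∈ f'.support, u ∈ D ∧ κ' u < κ' w := by
      intro u hu
      have hne : u ≠ w := by rintro rfl; exact (Finsupp.mem_support_iff.mp hu) hf'w
      have hle : κ' u ≤ κ' w := by
        by_contra hlt
        have h1 : f u = 0 := by
          by_contra h1; exact hlt (hf u (Finsupp.mem_support_iff.mpr h1)).2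
        have h2 : g w u = 0 := by
          by_contra h2; exact hlt (hg w u (Finsupp.mem_support_iff.mpr h2))
        apply Finsupp.mem_support_iff.mp hu
        simp [f', h1, h2, Finsupp.single_eq_of_ne hne]
      exact ⟨hD u w hle hw, lt_of_le_of_ne hle fun he => hne (h.injective he)⟩
    obtain ⟨r, h1, h2, h3⟩ := below f' hf'
    have hrw : r w = 0 := by
      by_contra hr
      exact lt_irrefl _ (h3 w (Finsupp.mem_support_iff.mpr hr))
    refine ⟨r + Finsupp.single w (f w % g w w), ?_, fun v => ?_, fun u hu => ?_⟩
    · have : f - (r + Finsupp.single w (f w % g w w)) = (f' - r) + (f w / g w w) • g w := by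
        simp only [f']; abel
      rw [this]
      exact add_mem h1 (zsmul_mem (AddSubgroup.subset_closure (Set.mem_image_of_mem g hw)) _)
    · by_cases hv : v = w
      · subst hv
        simp [hrw]
      · simpa [Finsupp.single_eq_of_ne hv] using h2 v
    · by_cases hu' : u = w
      · rw [hu']
      · refine (h3 u ?_).le
        simpa [Finsupp.single_eq_of_ne hu'] using hu
  rcases f.support.eq_empty_or_nonempty with he | hne
  · exact ⟨0, by simp [Finsupp.support_eq_empty.mp he], by simp⟩
  · obtain ⟨m, hm, hmax⟩ := Finset.exists_max_image f.support κ' hne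
    obtain ⟨r, h1, h2, -⟩ := key m f fun u hu => ⟨hf u hu, hmax u hu⟩
    exact ⟨r, h1, h2⟩

open Filter in
/-- Given a sequence of shift orders, a translation-stable group has generators, finitely many up
to translation, which are standard for almost all orders in the sequence. -/
lemma exists_standard_basis {κ : ℕ → Fin n × ℕ → O} (h : ∀ N, IsShiftOrder (κ N))
    (ω : Ultrafilter ℕ) (Λ : AddSubgroup ((Fin n × ℕ) →₀ ℤ))
    (hΛ : ∀ k, ∀ f ∈ Λ, shiftBy k f ∈ Λ) :
    ∃ (J : Fin n → ℕ) (g : Fin n × ℕ → ((Fin n × ℕ) →₀ ℤ)),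
      (∀ v, g v ∈ Λ) ∧
      (∀ i j, g (i, j) = shiftBy (j - min j (J i)) (g (i, min j (J i)))) ∧
      ∀ᶠ N in ω, (∀ v, ∀ u ∈ (g v).support, κ N u ≤ κ N v) ∧
        ∀ D : Set (Fin n × ℕ), (∀ u v, κ N u ≤ κ N v → v ∈ D → u ∈ D) →
          ∀ f ∈ Λ, (∀ u ∈ f.support, u ∈ D) → f ∈ AddSubgroup.closure (g '' D) := by
  classical
  let κ' : Fin n × ℕ → Germ (ω : Filter ℕ) O := fun v => ((fun N => κ N v : ℕ → O) : Germ _ O)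
  have hlt : ∀ u v, κ' u < κ' v ↔ ∀ᶠ N in ω, κ N u < κ N v := fun u v => Germ.coe_lt
  have hle : ∀ u v, κ' u ≤ κ' v ↔ ∀ᶠ N in ω, κ N u ≤ κ N v := fun u v => Germ.coe_le
  have h' : IsShiftOrder κ' :=
    { injective := fun u v huv => by
        obtain ⟨N, hN⟩ := (Germ.coe_eq.mp huv).exists
        exact (h N).injective hN
      lt_shift := fun i j => (hlt _ _).mpr (Eventually.of_forall fun N => (h N).lt_shift i j)
      shift_lt_shift := fun i j i' j' hh => (hlt _ _).mpr <|
        ((hlt _ _).mp hh).mono fun N => (h N).shift_lt_shift i j i' j' }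
  obtain ⟨J, g, hgΛ, hsupp, hdvd, hshift⟩ := h'.exists_basis Λ hΛ
  refine ⟨J, g, hgΛ, hshift, ?_⟩
  have hfin : ∀ᶠ N in ω, ∀ i, ∀ j ∈ Finset.range (J i + 1), ∀ u ∈ (g (i, j)).support,
      κ N u ≤ κ N (i, j) := by
    refine eventually_all.mpr fun i => (eventually_all_finset _).mpr fun j _ =>
      (eventually_all_finset _).mpr fun u hu => (hle _ _).mp (hsupp _ u hu)
  filter_upwards [hfin] with N hN
  have hsuppN : ∀ v, ∀ u ∈ (g v).support, κ N u ≤ κ N v := by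
    rintro ⟨i, j⟩ ⟨i', j'⟩ hu
    rw [hshift, Finsupp.mem_support_iff] at hu
    obtain ⟨m, rfl, hm⟩ := exists_of_shiftBy_ne_zero hu
    have := (h N).shift_le_shift (j - min j (J i)) (hN i (min j (J i))
      (Finset.mem_range_succ_iff.mpr (min_le_right _ _)) _ (Finsupp.mem_support_iff.mpr hm))
    rwa [Nat.add_sub_cancel' (min_le_left _ _)] at this
  refine ⟨hsuppN, fun D hD f hf hfD => ?_⟩
  obtain ⟨r, hr, hred⟩ := exists_reduced (h N) g hsuppN D hD f hfD
  suffices r = 0 by simpa [this] using hr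
  have hrΛ : r ∈ Λ := by
    have := (AddSubgroup.closure_le Λ).mpr (by rintro _ ⟨v, -, rfl⟩; exact hgΛ v) hr
    simpa using Λ.sub_mem hf this
  by_contra hne
  obtain ⟨m, hm, hmax⟩ := Finset.exists_max_image r.support κ'
    (Finsupp.support_nonempty_iff.mpr hne)
  refine Finsupp.mem_support_iff.mp hm ?_
  rw [← hred m]
  exact Int.emod_eq_zero_of_dvd (hdvd m r hrΛ hmax)

end IsShiftOrder
/-- The key ordering the variables with first index outside `φ` first, and then by the
difference of the second index to the bound `b`. -/
noncomputable def boundKey {n : ℕ} (φ : Set (Fin n)) (b : Fin n → ℕ) (u : Fin n × ℕ) :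
    ℕ ×ₗ (ℤ ×ₗ Fin n) :=
  toLex (φ.indicator 1 u.1, toLex ((u.2 : ℤ) - b u.1, u.1))

section BoundKey

variable {n : ℕ}

lemma boundKey_isShiftOrder (φ : Set (Fin n)) (b : Fin n → ℕ) : IsShiftOrder (boundKey φ b) where
  injective := by
    rintro ⟨i, j⟩ ⟨i', j'⟩ h
    simp only [boundKey, EmbeddingLike.apply_eq_iff_eq, Prod.mk.injEq] at h
    obtain ⟨-, h1, rfl⟩ := h
    simpa using h1
  lt_shift i j := by
    simp [boundKey, Prod.Lex.toLex_lt_toLex]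
  shift_lt_shift i j i' j' h := by
    simp only [boundKey, Prod.Lex.toLex_lt_toLex] at h ⊢
    push_cast
    rcases h with h | ⟨h, h1 | ⟨h1, h2⟩⟩
    · exact Or.inl h
    · exact Or.inr ⟨h, Or.inl (by linarith)⟩
    · exact Or.inr ⟨h, Or.inr ⟨by linarith, h2⟩⟩

lemma mem_of_boundKey_le {φ : Set (Fin n)} {b : Fin n → ℕ} {i i' : Fin n} {j j' : ℕ}
    (h : boundKey φ b (i, j) ≤ boundKey φ b (i', j')) (hi : i ∈ φ) :
    i' ∈ φ ∧ (j : ℤ) - b i ≤ j' - b i' := by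
  by_cases hi' : i' ∈ φ
  · refine ⟨hi', ?_⟩
    simp only [boundKey, Set.indicator_of_mem hi, Set.indicator_of_mem hi',
      Prod.Lex.toLex_le_toLex] at h
    rcases h with h | ⟨-, h | ⟨h, -⟩⟩
    · exact absurd h (lt_irrefl _)
    · exact h.le
    · exact h.le
  · simp [boundKey, Set.indicator_of_mem hi, Set.indicator_of_notMem hi',
      Prod.Lex.toLex_le_toLex] at h

/-- The variables with first index in `φ` and second index at least `b`. -/
def beyond (φ : Set (Fin n)) (b : Fin n → ℕ) : Set (Fin n × ℕ) :=
  {u | u.1 ∈ φ ∧ b u.1 ≤ u.2}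

lemma boundKey_lower (φ : Set (Fin n)) (b : Fin n → ℕ) (d : ℤ) (u v : Fin n × ℕ)
    (h : boundKey φ b u ≤ boundKey φ b v)
    (hv : v.1 ∈ φ → (v.2 : ℤ) - b v.1 ≤ d) (hu : u.1 ∈ φ) : (u.2 : ℤ) - b u.1 ≤ d :=
  have := mem_of_boundKey_le (i := u.1) (j := u.2) (i' := v.1) (j' := v.2) h hu
  this.2.trans (hv this.1)

open Classical in
/-- The extremal coefficients of an element of `Λ` reaching beyond the bound are combinations of
the extremal coefficients of the members of a standard basis. -/
lemma exists_top_combination {φ : Set (Fin n)} {b : Fin n → ℕ} {J : Fin n → ℕ}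
    {g : Fin n × ℕ → ((Fin n × ℕ) →₀ ℤ)} {Λ : AddSubgroup ((Fin n × ℕ) →₀ ℤ)}
    (hshift : ∀ i j k, J i ≤ j → g (i, j + k) = shiftBy k (g (i, j)))
    (hJ : ∀ i ∈ φ, J i ≤ b i)
    (hsupp : ∀ v, ∀ u ∈ (g v).support, boundKey φ b u ≤ boundKey φ b v)
    (hgen : ∀ D : Set (Fin n × ℕ), (∀ u v, boundKey φ b u ≤ boundKey φ b v → v ∈ D → u ∈ D) →
      ∀ f ∈ Λ, (∀ u ∈ f.support, u ∈ D) → f ∈ AddSubgroup.closure (g '' D))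
    (f : (Fin n × ℕ) →₀ ℤ) (hf : f ∈ Λ) (hpos : ∀ u ∈ beyond φ b, 0 ≤ f u)
    (hne : ∃ u ∈ beyond φ b, f u ≠ 0) :
    ∃ a : Fin n → ℤ,
      (∀ i ∈ φ, 0 ≤ ∑ i' with i' ∈ φ, a i' * g (i', b i') (i, b i)) ∧
      ∃ i ∈ φ, 0 < ∑ i' with i' ∈ φ, a i' * g (i', b i') (i, b i) := by
  let T := f.support.filter fun u => u ∈ beyond φ b
  have hT : T.Nonempty := by
    obtain ⟨u, hu, hfu⟩ := hne
    exact ⟨u, by simp [T, hu, hfu]⟩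
  obtain ⟨m, hm, hmax⟩ := Finset.exists_max_image T (fun u => u.2 - b u.1) hT
  simp only [T, Finset.mem_filter, Finsupp.mem_support_iff] at hm hmax
  set d := m.2 - b m.1 with hd
  let D : Set (Fin n × ℕ) := {u | u.1 ∈ φ → (u.2 : ℤ) - b u.1 ≤ d}
  have hfD : ∀ u ∈ f.support, u ∈ D := by
    intro u hu hφ
    by_cases hb : b u.1 ≤ u.2
    · have := hmax u ⟨Finsupp.mem_support_iff.mp hu, hφ, hb⟩
      omega
    · omega
  have hcl := hgen D (fun u v h hv => boundKey_lower φ b d u v h hv) f hf hfD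
  have hcomb : ∀ x ∈ AddSubgroup.closure (g '' D), ∃ a : Fin n → ℤ, ∀ i ∈ φ,
      x (i, b i + d) = ∑ i' with i' ∈ φ, a i' * g (i', b i') (i, b i) := by
    intro x hx
    induction hx using AddSubgroup.closure_induction with
    | mem x hx =>
      obtain ⟨⟨i', j'⟩, hv, rfl⟩ := hx
      by_cases hi' : i' ∈ φ ∧ j' = b i' + d
      · obtain ⟨hi', rfl⟩ := hi'
        refine ⟨Pi.single i' 1, fun i hi => ?_⟩
        rw [hshift i' (b i') d (hJ i' hi'), shiftBy_apply_add, Finset.sum_eq_single i']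
        · simp
        · intro k _ hk
          simp [Pi.single_eq_of_ne hk]
        · intro hk
          simp [hi'] at hk
      · refine ⟨0, fun i hi => ?_⟩
        simp only [Pi.zero_apply, zero_mul, Finset.sum_const_zero]
        by_contra hx
        obtain ⟨h1, h2⟩ := mem_of_boundKey_le (hsupp _ _ (Finsupp.mem_support_iff.mpr hx)) hi
        have h3 := hv h1
        simp only at h3
        push_cast at h2
        exact hi' ⟨h1, by omega⟩
    | zero => exact ⟨0, by simp⟩
    | add x y _ _ hx hy =>
      obtain ⟨a, ha⟩ := hx
      obtain ⟨a', ha'⟩ := hy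
      refine ⟨a + a', fun i hi => ?_⟩
      simp [ha i hi, ha' i hi, add_mul, Finset.sum_add_distrib]
    | neg x _ hx =>
      obtain ⟨a, ha⟩ := hx
      exact ⟨-a, fun i hi => by simp [ha i hi]⟩
  obtain ⟨a, ha⟩ := hcomb f hcl
  refine ⟨a, fun i hi => ?_, m.1, hm.2.1, ?_⟩
  · rw [← ha i hi]
    exact hpos _ ⟨hi, Nat.le_add_right _ _⟩
  · rw [← ha _ hm.2.1, hd, Nat.add_sub_cancel' hm.2.2]
    exact lt_of_le_of_ne (hpos _ hm.2) (Ne.symm hm.1)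

end BoundKey

open Filter in
open Classical in
/-- If almost all bounds are respected by every single sign condition on translates, then the
sign condition holds uniformly for almost all bounds. -/
lemma eventually_sign_condition {n : ℕ} (ω : Ultrafilter ℕ) (hω : (ω : Filter ℕ) ≤ atTop)
    {φ : ℕ → Set (Fin n)} {b : ℕ → Fin n → ℕ} (hb : ∀ N, ∀ i ∈ φ N, N < b N i)
    {J : Fin n → ℕ} {g : Fin n × ℕ → ((Fin n × ℕ) →₀ ℤ)}
    {Λ : AddSubgroup ((Fin n × ℕ) →₀ ℤ)} (hgΛ : ∀ v, g v ∈ Λ)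
    (hshift : ∀ i j k, J i ≤ j → g (i, j + k) = shiftBy k (g (i, j)))
    (hstd : ∀ᶠ N in ω,
      (∀ v, ∀ u ∈ (g v).support, boundKey (φ N) (b N) u ≤ boundKey (φ N) (b N) v) ∧
      ∀ D : Set (Fin n × ℕ),
        (∀ u v, boundKey (φ N) (b N) u ≤ boundKey (φ N) (b N) v → v ∈ D → u ∈ D) →
        ∀ f ∈ Λ, (∀ u ∈ f.support, u ∈ D) → f ∈ AddSubgroup.closure (g '' D))
    (hsign : ∀ f ∈ Λ, ∀ᶠ N in ω, ∀ k, (∀ u ∈ beyond (φ N) (b N), 0 ≤ shiftBy k f u) →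
      ∀ u ∈ beyond (φ N) (b N), shiftBy k f u = 0) :
    ∀ᶠ N in ω, ∀ f ∈ Λ, (∀ u ∈ beyond (φ N) (b N), 0 ≤ f u) →
      ∀ u ∈ beyond (φ N) (b N), f u = 0 := by
  have hlarge : ∀ m : ℕ, ∀ᶠ N in ω, m ≤ N := fun m => hω (eventually_ge_atTop m)
  have hJ : ∀ᶠ N in ω, ∀ i ∈ φ N, J i ≤ b N i := by
    have : ∀ᶠ N in ω, ∀ i, J i ≤ N := eventually_all.mpr fun i => hlarge (J i)
    filter_upwards [this] with N hN i hi
    exact (hN i).trans (hb N i hi).le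
  by_contra hcon
  rw [← Ultrafilter.eventually_not] at hcon
  let τ (N : ℕ) (a : Fin n → ℤ) (i : Fin n) : ℤ :=
    ∑ i' with i' ∈ φ N, a i' * g (i', b N i') (i, b N i)
  have hbad : ∀ᶠ N in ω, ∃ i₀, i₀ ∈ φ N ∧
      ∃ a : Fin n → ℤ, (∀ i ∈ φ N, 0 ≤ τ N a i) ∧ 0 < τ N a i₀ := by
    filter_upwards [hcon, hJ, hstd] with N hN hJN hstdN
    push Not at hN
    obtain ⟨f, hf, hpos, hne⟩ := hN
    obtain ⟨a, h1, i₀, h2, h3⟩ :=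
      exists_top_combination hshift hJN hstdN.1 hstdN.2 f hf hpos hne
    exact ⟨i₀, h2, a, h1, h3⟩
  obtain ⟨i₀, hi₀⟩ := Ultrafilter.eventually_exists_iff.mp hbad
  let B : Set (Fin n) := {i | ∃ c : ℤ, ∀ᶠ N in ω, i ∈ φ N ∧ (b N i : ℤ) - b N i₀ = c}
  have hi₀B : i₀ ∈ B := ⟨0, hi₀.mono fun N hN => ⟨hN.1, sub_self _⟩⟩
  choose! c hc using fun (i : Fin n) (hi : i ∈ B) => hi
  have hcB : ∀ᶠ N in ω, ∀ i ∈ B, i ∈ φ N ∧ (b N i : ℤ) - b N i₀ = c i :=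
    eventually_all.mpr fun i => by
      by_cases hi : i ∈ B
      · exact (hc i hi).mono fun N hN _ => hN
      · exact Eventually.of_forall fun N h => absurd h hi
  have hsep : ∀ᶠ N in ω, ∀ i i', (i ∈ B ↔ i' ∉ B) → i ∈ φ N → i' ∈ φ N →
      g (i', b N i') (i, b N i) = 0 := by
    refine eventually_all.mpr fun i => eventually_all.mpr fun i' => ?_
    by_cases hii : i ∈ B ↔ i' ∉ B
    swap
    · exact Eventually.of_forall fun N h => absurd h hii
    have hne : ∀ e : ℤ, ∀ᶠ N in ω, ¬ (i ∈ φ N ∧ i' ∈ φ N ∧ (b N i : ℤ) - b N i' = e) := by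
      intro e
      rw [Ultrafilter.eventually_not]
      intro he
      by_cases hi : i ∈ B
      · refine hii.mp hi ⟨c i - e, ?_⟩
        filter_upwards [he, hcB] with N h1 h2
        exact ⟨h1.2.1, by linarith [(h2 i hi).2]⟩
      · have hi' : i' ∈ B := by tauto
        refine hi ⟨c i' + e, ?_⟩
        filter_upwards [he, hcB] with N h1 h2
        exact ⟨h1.1, by linarith [(h2 i' hi').2]⟩
    have hall : ∀ᶠ N in ω, ∀ u ∈ (g (i', J i')).support,
        ¬ (i ∈ φ N ∧ i' ∈ φ N ∧ (b N i : ℤ) - b N i' = u.2 - J i') :=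
      (eventually_all_finset _).mpr fun u _ => hne _
    filter_upwards [hall, hJ] with N hN hJN _ hi hi'
    by_contra h0
    have hJi := hJN i' hi'
    rw [← Nat.add_sub_cancel' hJi, hshift i' (J i') _ le_rfl] at h0
    obtain ⟨m, hm, hg⟩ := exists_of_shiftBy_ne_zero h0
    exact hN (i, m) (Finsupp.mem_support_iff.mpr hg) ⟨hi, hi', by simp only; omega⟩
  obtain ⟨N₀, hN₀, hc₀, hsep₀, hJ₀⟩ := (hi₀.and (hcB.and (hsep.and hJ))).exists
  obtain ⟨hφ₀, a, hτ, hτpos⟩ := hN₀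
  let f : (Fin n × ℕ) →₀ ℤ := ∑ i' with i' ∈ B, a i' • g (i', b N₀ i')
  have hf : f ∈ Λ := sum_mem fun i _ => zsmul_mem (hgΛ _) _
  have hf_top : ∀ i ∈ B, f (i, b N₀ i) = τ N₀ a i := by
    intro i hi
    simp only [f, τ, Finsupp.finsetSum_apply, Finsupp.smul_apply, smul_eq_mul]
    refine Finset.sum_subset (fun i' hi' => ?_) fun i' h1 h2 => ?_
    · simp only [Finset.mem_filter, Finset.mem_univ, true_and] at hi' ⊢
      exact (hc₀ i' hi').1
    · simp only [Finset.mem_filter, Finset.mem_univ, true_and] at h1 h2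
      rw [hsep₀ i i' (by tauto) (hc₀ i hi).1 h1, mul_zero]
  obtain ⟨N, hN, hcN, hsepN, hstdN, hφN, hlN⟩ :=
    ((hsign f hf).and (hcB.and (hsep.and (hstd.and (hi₀.and (hlarge (b N₀ i₀))))))).exists
  have hbN := hb N i₀ hφN.1
  set k := b N i₀ - b N₀ i₀ with hk
  have hbB : ∀ i ∈ B, b N i = b N₀ i + k := by
    intro i hi
    have h1 := (hcN i hi).2
    have h2 := (hc₀ i hi).2
    omega
  have hfk : shiftBy k f = ∑ i' with i' ∈ B, a i' • g (i', b N i') := by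
    simp only [f, map_sum, map_zsmul]
    refine Finset.sum_congr rfl fun i hi => ?_
    simp only [Finset.mem_filter, Finset.mem_univ, true_and] at hi
    rw [hbB i hi, hshift i _ k (hJ₀ i (hc₀ i hi).1)]
  have hval : ∀ i ∈ B, shiftBy k f (i, b N i) = τ N₀ a i := by
    intro i hi
    rw [hbB i hi, shiftBy_apply_add, hf_top i hi]
  refine absurd (hN k ?_ (i₀, b N i₀) ⟨hφN.1, le_rfl⟩) (by rw [hval i₀ hi₀B]; exact hτpos.ne')
  rintro ⟨i, j⟩ ⟨hi, hj⟩
  simp only at hi hj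
  by_cases hiB : i ∈ B ∧ j = b N i
  · obtain ⟨hiB, rfl⟩ := hiB
    rw [hval i hiB]
    exact hτ i (hc₀ i hiB).1
  · refine le_of_eq (Eq.symm ?_)
    rw [hfk]
    simp only [Finsupp.finsetSum_apply, Finsupp.smul_apply, smul_eq_mul]
    refine Finset.sum_eq_zero fun i' hi' => ?_
    simp only [Finset.mem_filter, Finset.mem_univ, true_and] at hi'
    by_contra h0
    have h1 : g (i', b N i') (i, j) ≠ 0 := fun h => h0 (by rw [h, mul_zero])
    have h2 := (mem_of_boundKey_le (hstdN.1 _ _ (Finsupp.mem_support_iff.mpr h1)) hi).2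
    have h3 : j = b N i := by omega
    subst h3
    exact h1 (hsepN i i' (by tauto) hi (hcN i' hi').1)

/-- The inclusion of natural exponents into integral exponents. -/
noncomputable def castE {n : ℕ} : ((Fin n × ℕ) →₀ ℕ) →+ ((Fin n × ℕ) →₀ ℤ) :=
  Finsupp.mapRange.addMonoidHom (Nat.castAddMonoidHom ℤ)

/-- The positive part of an integral exponent. -/
noncomputable def expPos {n : ℕ} (f : (Fin n × ℕ) →₀ ℤ) : (Fin n × ℕ) →₀ ℕ :=
  f.mapRange Int.toNat rfl

section Exponents

variable {n : ℕ}

@[simp]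
lemma castE_apply (e : (Fin n × ℕ) →₀ ℕ) (v : Fin n × ℕ) : castE e v = e v := rfl

@[simp]
lemma expPos_apply (f : (Fin n × ℕ) →₀ ℤ) (v : Fin n × ℕ) : expPos f v = (f v).toNat := rfl

@[simp]
lemma castE_single (v : Fin n × ℕ) (k : ℕ) :
    castE (Finsupp.single v k) = Finsupp.single v (k : ℤ) :=
  Finsupp.mapRange_single (hf := rfl)

lemma castE_expPos_sub (f : (Fin n × ℕ) →₀ ℤ) : castE (expPos f) - castE (expPos (-f)) = f := by
  ext v
  simp

lemma shiftBy_expPos (k : ℕ) (f : (Fin n × ℕ) →₀ ℤ) :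
    shiftBy k (expPos f) = expPos (shiftBy k f) := by
  ext ⟨i, j⟩
  by_cases h : k ≤ j
  · simp [shiftBy_apply_of_le h]
  · have h1 : ∀ {M : Type} [AddCommMonoid M] (f : (Fin n × ℕ) →₀ M), shiftBy k f (i, j) = 0 := by
      intro M _ f
      by_contra h0
      obtain ⟨m, hm, -⟩ := exists_of_shiftBy_ne_zero h0
      omega
    simp [h1]

lemma shiftBy_castE (k : ℕ) (e : (Fin n × ℕ) →₀ ℕ) :
    shiftBy k (castE e) = castE (shiftBy k e) := by
  induction e using Finsupp.induction_linear with
  | zero => simp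
  | add f g hf hg => simp [hf, hg]
  | single v m => simp [shiftBy_def, Finsupp.mapDomain_single]

end Exponents

section Character

variable {K : Type*} [Field K] {n : ℕ} {F : Type*} [Field F] [Algebra K F]

open Classical in
/-- The value of a variable, replaced by `1` where it vanishes. -/
noncomputable def unitVal (θ : DPoly K n →ₐ[K] F) (v : Fin n × ℕ) : Fˣ :=
  if h : θ (MvPolynomial.X v) = 0 then 1 else Units.mk0 _ h

/-- The character of the exponent group attached to a point. -/
noncomputable def charHom (θ : DPoly K n →ₐ[K] F) : ((Fin n × ℕ) →₀ ℤ) →+ Additive Fˣ :=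
  Finsupp.liftAddHom fun v => zmultiplesHom _ (Additive.ofMul (unitVal θ v))

/-- The values of `charHom` in the field. -/
noncomputable def charVal (θ : DPoly K n →ₐ[K] F) (f : (Fin n × ℕ) →₀ ℤ) : F :=
  ((charHom θ f).toMul : Fˣ)

variable (θ : DPoly K n →ₐ[K] F)

@[simp]
lemma charVal_zero : charVal θ 0 = 1 := by simp [charVal]

lemma charVal_add (f g : (Fin n × ℕ) →₀ ℤ) :
    charVal θ (f + g) = charVal θ f * charVal θ g := by
  simp [charVal]

lemma charVal_nsmul (k : ℕ) (f : (Fin n × ℕ) →₀ ℤ) :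
    charVal θ (k • f) = charVal θ f ^ k := by
  simp [charVal]

lemma charVal_ne_zero (f : (Fin n × ℕ) →₀ ℤ) : charVal θ f ≠ 0 := Units.ne_zero _

lemma charVal_eq_iff (f g : (Fin n × ℕ) →₀ ℤ) :
    charVal θ f = charVal θ g ↔ f - g ∈ (charHom θ).ker := by
  rw [charVal, charVal, Units.val_inj, AddMonoidHom.mem_ker, map_sub, sub_eq_zero]
  exact Iff.rfl

lemma charVal_single_one {v : Fin n × ℕ} (h : θ (MvPolynomial.X v) ≠ 0) :
    charVal θ (Finsupp.single v 1) = θ (MvPolynomial.X v) := by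
  simp [charVal, charHom, unitVal, h]

lemma map_monomial_eq_charVal {e : (Fin n × ℕ) →₀ ℕ} (c : K)
    (h : ∀ v ∈ e.support, θ (MvPolynomial.X v) ≠ 0) :
    θ (MvPolynomial.monomial e c) = algebraMap K F c * charVal θ (castE e) := by
  classical
  rw [MvPolynomial.monomial_eq, map_mul, ← MvPolynomial.algebraMap_eq, AlgHom.commutes]
  congr 1
  rw [Finsupp.prod, map_prod]
  have h1 : castE e = ∑ v ∈ e.support, e v • Finsupp.single v (1 : ℤ) := by
    conv_lhs => rw [← Finsupp.sum_single e, Finsupp.sum, map_sum]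
    simp
  rw [h1]
  have h2 : ∀ s ⊆ e.support, charVal θ (∑ v ∈ s, e v • Finsupp.single v (1 : ℤ)) =
      ∏ v ∈ s, θ (MvPolynomial.X v ^ e v) := by
    intro s
    induction s using Finset.induction_on with
    | empty => simp
    | insert a s ha ih =>
      intro hs
      rw [Finset.sum_insert ha, Finset.prod_insert ha, charVal_add, charVal_nsmul,
        charVal_single_one θ (h a (hs (Finset.mem_insert_self a s))),
        ih ((Finset.subset_insert a s).trans hs), map_pow]
  exact (h2 _ subset_rfl).symm

lemma map_monomial_eq_zero {e : (Fin n × ℕ) →₀ ℕ} (c : K) {v : Fin n × ℕ} (hv : v ∈ e.support)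
    (h : θ (MvPolynomial.X v) = 0) : θ (MvPolynomial.monomial e c) = 0 := by
  rw [MvPolynomial.monomial_eq, map_mul, Finsupp.prod, map_prod,
    Finset.prod_eq_zero hv (by rw [map_pow, h, zero_pow (Finsupp.mem_support_iff.mp hv)]), mul_zero]

lemma map_monomial_one_eq_zero_iff {e : (Fin n × ℕ) →₀ ℕ} :
    θ (MvPolynomial.monomial e 1) = 0 ↔ ∃ v ∈ e.support, θ (MvPolynomial.X v) = 0 := by
  constructor
  · intro h
    by_contra! h0
    rw [map_monomial_eq_charVal θ 1 h0, map_one, one_mul] at h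
    exact charVal_ne_zero θ _ h
  · rintro ⟨v, hv, h⟩
    exact map_monomial_eq_zero θ 1 hv h

/-- The pure binomial with prescribed difference of exponents. -/
noncomputable def binom (K : Type*) [Field K] {n : ℕ} (f : (Fin n × ℕ) →₀ ℤ) : DPoly K n :=
  MvPolynomial.monomial (expPos f) 1 - MvPolynomial.monomial (expPos (-f)) 1

lemma map_binom_eq_zero_iff {f : (Fin n × ℕ) →₀ ℤ}
    (h : ∀ v ∈ f.support, θ (MvPolynomial.X v) ≠ 0) :
    θ (binom K f) = 0 ↔ f ∈ (charHom θ).ker := by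
  have h1 : ∀ v ∈ (expPos f).support, θ (MvPolynomial.X v) ≠ 0 := fun v hv =>
    h v (by
      simp only [Finsupp.mem_support_iff, expPos_apply] at hv ⊢
      omega)
  have h2 : ∀ v ∈ (expPos (-f)).support, θ (MvPolynomial.X v) ≠ 0 := fun v hv =>
    h v (by
      simp only [Finsupp.mem_support_iff, expPos_apply, Finsupp.neg_apply] at hv ⊢
      omega)
  rw [binom, map_sub, sub_eq_zero, map_monomial_eq_charVal θ 1 h1,
    map_monomial_eq_charVal θ 1 h2, map_one, one_mul, one_mul, charVal_eq_iff, castE_expPos_sub]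

end Character

section ShiftMonomial

variable {K : Type*} [Field K] {n : ℕ} (σK : K →+* K)

lemma shift_X (v : Fin n × ℕ) :
    shift σK (MvPolynomial.X v) = MvPolynomial.X (v.1, v.2 + 1) := by
  simp [shift]

lemma shift_monomial (e : (Fin n × ℕ) →₀ ℕ) (c : K) :
    shift σK (MvPolynomial.monomial e c) = MvPolynomial.monomial (shiftBy 1 e) (σK c) := by
  classical
  rw [shift, MvPolynomial.coe_eval₂Hom, MvPolynomial.eval₂_monomial, MvPolynomial.monomial_eq,
    shiftBy_def, Finsupp.prod_mapDomain_index_inj (add_right_var_injective 1)]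
  rfl

lemma shift_binom (f : (Fin n × ℕ) →₀ ℤ) : shift σK (binom K f) = binom K (shiftBy 1 f) := by
  simp only [binom, map_sub, shift_monomial, map_one, shiftBy_expPos, map_neg]

lemma binom_shiftBy_mem {P : Ideal (DPoly K n)} (hP : IsSigmaIdeal (shift σK) P)
    {f : (Fin n × ℕ) →₀ ℤ} (hf : binom K f ∈ P) (k : ℕ) : binom K (shiftBy k f) ∈ P := by
  induction k with
  | zero => simpa using hf
  | succ k ih =>
    have := hP _ ih
    rwa [shift_binom, shiftBy_shiftBy] at this

lemma X_add_mem {P : Ideal (DPoly K n)} (hP : IsSigmaIdeal (shift σK) P) {i : Fin n} {j : ℕ}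
    (h : (MvPolynomial.X (i, j) : DPoly K n) ∈ P) (k : ℕ) :
    (MvPolynomial.X (i, j + k) : DPoly K n) ∈ P := by
  induction k with
  | zero => exact h
  | succ k ih =>
    have := hP _ ih
    rwa [shift_X] at this

end ShiftMonomial

section RadicalWellMixed

variable {R : Type*} [CommRing R] {σ : R →+* R}

lemma isWellMixed_of_isPrime {P : Ideal R} [hp : P.IsPrime] (hP : IsSigmaIdeal σ P) :
    IsWellMixed σ P := by
  intro a b hab
  rcases hp.mem_or_mem hab with h | h
  · exact P.mul_mem_right _ h
  · exact P.mul_mem_left _ (hP b h)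

lemma subset_rwmClosure (F : Set R) : F ⊆ rwmClosure σ F := by
  intro x hx
  simp only [rwmClosure, SetLike.mem_coe, Submodule.mem_sInf]
  exact fun I hI => hI.1 hx

lemma rwmClosure_le_of_isPrime {F : Set R} {P : Ideal R} [hp : P.IsPrime]
    (hP : IsSigmaIdeal σ P) (hF : F ⊆ P) : rwmClosure σ F ≤ P :=
  sInf_le ⟨hF, hP, isWellMixed_of_isPrime hP, hp.isRadical⟩

lemma rwmClosure_mono {F G : Set R} (h : F ⊆ G) : rwmClosure σ F ≤ rwmClosure σ G :=
  sInf_le_sInf fun _ hI => ⟨h.trans hI.1, hI.2⟩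

lemma rwmClosure_isWellMixed (F : Set R) : IsWellMixed σ (rwmClosure σ F) := by
  intro a b hab
  simp only [rwmClosure, Submodule.mem_sInf] at hab ⊢
  exact fun I hI => hI.2.2.1 a b (hab I hI)

lemma rwmClosure_isRadical (F : Set R) : (rwmClosure σ F).IsRadical := by
  rintro a ⟨k, hk⟩
  simp only [rwmClosure, Submodule.mem_sInf] at hk ⊢
  exact fun I hI => hI.2.2.2 ⟨k, hk I hI⟩

lemma IsWellMixed.isSigmaIdeal_of_mem_minimalPrimes {I P : Ideal R} (hI : IsWellMixed σ I)
    (hr : I.IsRadical) (hP : P ∈ I.minimalPrimes) : IsSigmaIdeal σ P := by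
  intro b hb
  have hp : P.IsPrime := hP.1.1
  obtain ⟨a, ha, hab⟩ : ∃ a ∉ P, a * b ∈ I := by
    by_contra! hdis
    obtain ⟨Q, hQ, hIQ, hQd⟩ := I.exists_le_prime_disjoint (P.primeCompl ⊔ Submonoid.powers b) (by
      rw [Set.disjoint_left]
      intro x hxI hx
      obtain ⟨a, ha, _, ⟨k, rfl⟩, rfl⟩ := Submonoid.mem_sup.mp hx
      refine hdis a ha (hr ⟨k + 1, ?_⟩)
      have : (a * b) ^ (k + 1) = a ^ k * b * (a * b ^ k) := by ring
      rw [this]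
      exact I.mul_mem_left _ hxI)
    rw [Set.disjoint_left] at hQd
    have hQP : Q ≤ P := fun x hx => by
      by_contra hxP
      exact hQd hx (Submonoid.mem_sup_left hxP)
    exact hQd (hP.2 ⟨hQ, hIQ⟩ hQP hb)
      (Submonoid.mem_sup_right (Submonoid.mem_powers b))
  exact (hp.mem_or_mem (hP.1.2 (hI a b hab))).resolve_left ha

lemma exists_isPrime_notMem_of_notMem_rwmClosure {F : Set R} {f : R} (hf : f ∉ rwmClosure σ F) :
    ∃ P : Ideal R, P.IsPrime ∧ IsSigmaIdeal σ P ∧ rwmClosure σ F ≤ P ∧ f ∉ P := by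
  have h : f ∉ sInf (rwmClosure σ F).minimalPrimes := by
    rwa [Ideal.sInf_minimalPrimes, (rwmClosure_isRadical F).radical]
  simp only [Submodule.mem_sInf, not_forall] at h
  obtain ⟨P, hP, hfP⟩ := h
  exact ⟨P, hP.1.1, (rwmClosure_isWellMixed F).isSigmaIdeal_of_mem_minimalPrimes
    (rwmClosure_isRadical F) hP, hP.1.2, hfP⟩

lemma sigmaIdealGen_le {S : Set R} {P : Ideal R} (hP : IsSigmaIdeal σ P) (hS : S ⊆ P) :
    sigmaIdealGen σ S ≤ P := sInf_le ⟨hS, hP⟩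

lemma subset_sigmaIdealGen (S : Set R) : S ⊆ sigmaIdealGen σ S := by
  intro x hx
  simp only [sigmaIdealGen, SetLike.mem_coe, Submodule.mem_sInf]
  exact fun I hI => hI.1 hx

end RadicalWellMixed

section Monomials

variable {K : Type*} [Field K] {n : ℕ} (σK : K →+* K)

lemma shift_iterate_X (i : Fin n) (k : ℕ) :
    (⇑(shift σK))^[k] (MvPolynomial.X (i, 0)) = MvPolynomial.X (i, k) := by
  induction k with
  | zero => rfl
  | succ k ih => rw [Function.iterate_succ_apply', ih, shift_X]

lemma varPow_eq_X (i : Fin n) (a : ℕ) : varPow σK i a = MvPolynomial.X (i, a) := by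
  rw [varPow, ypow, sexp]
  simp only [shift_iterate_X, Polynomial.natDegree_X_pow, Polynomial.coeff_X_pow]
  rw [Finset.prod_eq_single a]
  · simp
  · intro b _ hb
    simp [hb]
  · intro h
    simp at h

lemma exists_monom_eq (f : Fin n → Polynomial ℕ) :
    ∃ e : (Fin n × ℕ) →₀ ℕ, monom σK f = MvPolynomial.monomial e 1 := by
  let T : Submonoid (DPoly K n) :=
    MonoidHom.mrange (MvPolynomial.monomialOneHom K (Fin n × ℕ))
  have hX : ∀ v, (MvPolynomial.X v : DPoly K n) ∈ T := fun v =>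
    ⟨Multiplicative.ofAdd (Finsupp.single v 1), rfl⟩
  have h : monom σK f ∈ T := by
    rw [monom]
    refine Submonoid.prod_mem _ fun i _ => ?_
    rw [ypow, sexp]
    refine Submonoid.prod_mem _ fun j _ => ?_
    rw [shift_iterate_X]
    exact Submonoid.pow_mem _ (hX _) _
  obtain ⟨e, he⟩ := h
  exact ⟨e.toAdd, he.symm⟩

lemma notMem_of_mem_mSet {P : Ideal (DPoly K n)} [hp : P.IsPrime]
    (h : ∀ v, (MvPolynomial.X v : DPoly K n) ∉ P) {M : DPoly K n} (hM : M ∈ mSet K n) :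
    M ∉ P := by
  have hle : Submonoid.closure (Set.range fun v : Fin n × ℕ => (MvPolynomial.X v : DPoly K n)) ≤
      P.primeCompl := by
    rw [Submonoid.closure_le]
    rintro _ ⟨v, rfl⟩
    exact h v
  exact hle hM

end Monomials

/-- The evaluation of a difference polynomial at the generic point of a prime ideal. -/
noncomputable def primePoint {K : Type*} [Field K] {n : ℕ} (P : Ideal (DPoly K n)) [P.IsPrime] :
    DPoly K n →ₐ[K] FractionRing (DPoly K n ⧸ P) :=
  (IsScalarTower.toAlgHom K (DPoly K n ⧸ P) (FractionRing (DPoly K n ⧸ P))).comp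
    (Ideal.Quotient.mkₐ K P)

lemma primePoint_eq_zero_iff {K : Type*} [Field K] {n : ℕ} (P : Ideal (DPoly K n)) [P.IsPrime]
    (f : DPoly K n) : primePoint P f = 0 ↔ f ∈ P := by
  simp [primePoint, Ideal.Quotient.eq_zero_iff_mem]

section RationalGrading

variable {n : ℕ}

/-- The inclusion of integral exponents into rational exponents. -/
noncomputable def ratE : ((Fin n × ℕ) →₀ ℤ) →+ ((Fin n × ℕ) →₀ ℚ) :=
  Finsupp.mapRange.addMonoidHom (Int.castAddHom ℚ)

lemma ratE_injective : Function.Injective (ratE (n := n)) :=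
  Finsupp.mapRange_injective _ (map_zero _) Int.cast_injective

/-- The grading group obtained from a group of exponents by killing it rationally. -/
abbrev SatQuotient (Λ : AddSubgroup ((Fin n × ℕ) →₀ ℤ)) : Type :=
  ((Fin n × ℕ) →₀ ℚ) ⧸ Submodule.span ℚ (ratE '' (Λ : Set ((Fin n × ℕ) →₀ ℤ)))

/-- The degree map to `SatQuotient`. -/
noncomputable def satDegree (Λ : AddSubgroup ((Fin n × ℕ) →₀ ℤ)) :
    ((Fin n × ℕ) →₀ ℤ) →+ SatQuotient Λ :=
  (Submodule.mkQ _).toAddMonoidHom.comp ratE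

lemma satDegree_eq_zero_iff (Λ : AddSubgroup ((Fin n × ℕ) →₀ ℤ)) (x : (Fin n × ℕ) →₀ ℤ) :
    satDegree Λ x = 0 ↔ ∃ m : ℕ, 0 < m ∧ m • x ∈ Λ := by
  have h0 : satDegree Λ x = 0 ↔
      ratE x ∈ Submodule.span ℚ (ratE '' (Λ : Set ((Fin n × ℕ) →₀ ℤ))) :=
    Submodule.Quotient.mk_eq_zero _
  rw [h0]
  constructor
  · intro h
    have key : ∀ y ∈ Submodule.span ℚ (ratE '' (Λ : Set ((Fin n × ℕ) →₀ ℤ))),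
        ∃ m : ℕ, 0 < m ∧ ∃ z ∈ Λ, m • y = ratE z := by
      intro y hy
      induction hy using Submodule.span_induction with
      | mem y hy =>
        obtain ⟨z, hz, rfl⟩ := hy
        exact ⟨1, one_pos, z, hz, one_smul _ _⟩
      | zero => exact ⟨1, one_pos, 0, Λ.zero_mem, by simp⟩
      | add a b _ _ ha hb =>
        obtain ⟨m, hm, z, hz, h1⟩ := ha
        obtain ⟨m', hm', z', hz', h2⟩ := hb
        refine ⟨m * m', Nat.mul_pos hm hm', m' • z + m • z',
          Λ.add_mem (Λ.nsmul_mem hz _) (Λ.nsmul_mem hz' _), ?_⟩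
        rw [map_add, map_nsmul, map_nsmul, ← h1, ← h2, smul_add, smul_smul, smul_smul,
          mul_comm m' m]
      | smul q a _ ha =>
        obtain ⟨m, hm, z, hz, h1⟩ := ha
        refine ⟨m * q.den, Nat.mul_pos hm q.pos, q.num • z, Λ.zsmul_mem hz _, ?_⟩
        rw [map_zsmul, ← h1, ← Nat.cast_smul_eq_nsmul ℚ, ← Nat.cast_smul_eq_nsmul ℚ,
          ← Int.cast_smul_eq_zsmul ℚ, smul_smul, smul_smul]
        congr 1
        have := Rat.mul_den_eq_num q
        push_cast
        linear_combination (m : ℚ) * this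
    obtain ⟨m, hm, z, hz, h1⟩ := key _ h
    refine ⟨m, hm, ?_⟩
    rw [← map_nsmul] at h1
    rwa [ratE_injective h1]
  · rintro ⟨m, hm, hx⟩
    have h1 : ratE (m • x) ∈ Submodule.span ℚ (ratE '' (Λ : Set ((Fin n × ℕ) →₀ ℤ))) :=
      Submodule.subset_span ⟨_, hx, rfl⟩
    have h2 := Submodule.smul_mem _ ((m : ℚ)⁻¹) h1
    rwa [map_nsmul, ← Nat.cast_smul_eq_nsmul ℚ, smul_smul,
      inv_mul_cancel₀ (Nat.cast_ne_zero.mpr hm.ne'), one_smul] at h2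

lemma satDegree_shiftBy_eq_zero {Λ : AddSubgroup ((Fin n × ℕ) →₀ ℤ)}
    (hΛ : ∀ k, ∀ f ∈ Λ, shiftBy k f ∈ Λ) (k : ℕ) {x : (Fin n × ℕ) →₀ ℤ}
    (hx : satDegree Λ x = 0) : satDegree Λ (shiftBy k x) = 0 := by
  rw [satDegree_eq_zero_iff] at hx ⊢
  obtain ⟨m, hm, h⟩ := hx
  exact ⟨m, hm, by rw [← map_nsmul]; exact hΛ k _ h⟩

end RationalGrading

section Graded

variable {K : Type*} [Field K] {n : ℕ} {F : Type*} [Field F] [Algebra K F] {Γ : Type*}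
  [AddCommGroup Γ] (θ : DPoly K n →ₐ[K] F) (deg : ((Fin n × ℕ) →₀ ℤ) →+ Γ)

/-- The evaluation keeping track of the degrees of the variables. -/
noncomputable def gradedEval : DPoly K n →ₐ[K] AddMonoidAlgebra F Γ :=
  MvPolynomial.aeval fun v =>
    AddMonoidAlgebra.single (deg (Finsupp.single v 1)) (θ (MvPolynomial.X v))

lemma gradedEval_monomial (e : (Fin n × ℕ) →₀ ℕ) (c : K) :
    gradedEval θ deg (MvPolynomial.monomial e c) =
      AddMonoidAlgebra.single (deg (castE e)) (θ (MvPolynomial.monomial e c)) := by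
  induction e using Finsupp.induction_linear generalizing c with
  | zero =>
    rw [← MvPolynomial.C_apply, ← MvPolynomial.algebraMap_eq, AlgHom.commutes, AlgHom.commutes]
    simp
  | add f g hf hg =>
    have : MvPolynomial.monomial (f + g) c =
        MvPolynomial.monomial f c * MvPolynomial.monomial g 1 := by
      rw [MvPolynomial.monomial_mul, mul_one]
    rw [this, map_mul, hf, hg, AddMonoidAlgebra.single_mul_single, map_mul, map_add, map_add]
  | single v k =>
    have : (MvPolynomial.monomial (Finsupp.single v k) c : DPoly K n) =
        algebraMap K _ c * MvPolynomial.X v ^ k := by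
      rw [MvPolynomial.algebraMap_eq, MvPolynomial.C_mul_X_pow_eq_monomial]
    rw [this, map_mul, map_pow, AlgHom.commutes, map_mul, map_pow, AlgHom.commutes, castE_single,
      gradedEval, MvPolynomial.aeval_X, AddMonoidAlgebra.single_pow,
      AddMonoidAlgebra.coe_algebraMap, Function.comp_apply, AddMonoidAlgebra.single_mul_single, zero_add, ← map_nsmul]
    simp

open Classical in
/-- The homogeneous component of a difference polynomial. -/
noncomputable def gradedComponent (γ : Γ) (f : DPoly K n) : DPoly K n :=
  ∑ e ∈ f.support with deg (castE e) = γ, MvPolynomial.monomial e (f.coeff e)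

lemma degree_of_mem_support_gradedComponent {γ : Γ} {f : DPoly K n} {e : (Fin n × ℕ) →₀ ℕ}
    (he : e ∈ (gradedComponent deg γ f).support) : deg (castE e) = γ := by
  classical
  rw [gradedComponent] at he
  obtain ⟨e', he', h⟩ := Finset.mem_biUnion.mp (MvPolynomial.support_sum he)
  have := Finset.mem_singleton.mp (MvPolynomial.support_monomial_subset h)
  rw [this]
  exact (Finset.mem_filter.mp he').2

lemma exists_sum_gradedComponent (f : DPoly K n) :
    ∃ s : Finset Γ, f = ∑ γ ∈ s, gradedComponent deg γ f := by
  classical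
  refine ⟨f.support.image fun e => deg (castE e), ?_⟩
  have hmaps : ∀ e ∈ f.support, deg (castE e) ∈ f.support.image fun e => deg (castE e) :=
    fun e he => Finset.mem_image.mpr ⟨e, he, rfl⟩
  refine f.as_sum.trans ((Finset.sum_fiberwise_of_maps_to hmaps _).symm.trans
    (Finset.sum_congr rfl fun γ _ => ?_))
  rw [gradedComponent]

lemma coeff_gradedEval (f : DPoly K n) (γ : Γ) :
    (gradedEval θ deg f).coeff γ = θ (gradedComponent deg γ f) := by
  classical
  conv_lhs => rw [f.as_sum]
  rw [map_sum, AddMonoidAlgebra.coeff_sum, Finsupp.finsetSum_apply, gradedComponent, map_sum,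
    Finset.sum_filter]
  refine Finset.sum_congr rfl fun e _ => ?_
  rw [gradedEval_monomial, AddMonoidAlgebra.coeff_single, Finsupp.single_apply]

lemma gradedEval_eq_zero_iff (f : DPoly K n) :
    gradedEval θ deg f = 0 ↔ ∀ γ, θ (gradedComponent deg γ f) = 0 := by
  simp only [← coeff_gradedEval, ← AddMonoidAlgebra.coeff_eq_zero, Finsupp.ext_iff,
    Finsupp.coe_zero, Pi.zero_apply]

lemma gradedEval_shift_eq_zero (σK : K →+* K)
    (hdeg : ∀ x, deg x = 0 → deg (shiftBy 1 x) = 0)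
    (hθ : ∀ f, θ f = 0 → θ (shift σK f) = 0) {f : DPoly K n} (hf : gradedEval θ deg f = 0) :
    gradedEval θ deg (shift σK f) = 0 := by
  classical
  obtain ⟨s, hs⟩ := exists_sum_gradedComponent deg f
  rw [gradedEval_eq_zero_iff] at hf
  rw [hs, map_sum, map_sum]
  refine Finset.sum_eq_zero fun γ _ => ?_
  set g := gradedComponent deg γ f with hg
  have hgs : ∀ e ∈ g.support, deg (castE e) = γ := fun e he =>
    degree_of_mem_support_gradedComponent deg he
  rcases g.support.eq_empty_or_nonempty with h0 | ⟨e₀, he₀⟩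
  · rw [MvPolynomial.support_eq_empty.mp h0]
    simp
  have hsum : shift σK g = ∑ e ∈ g.support,
      MvPolynomial.monomial (shiftBy 1 e) (σK (g.coeff e)) := by
    conv_lhs => rw [g.as_sum]
    rw [map_sum]
    simp only [shift_monomial]
  have hh : gradedEval θ deg (shift σK g) =
      AddMonoidAlgebra.single (deg (castE (shiftBy 1 e₀))) (θ (shift σK g)) := by
    rw [hsum, map_sum, map_sum, ← AddMonoidAlgebra.coeff_inj, AddMonoidAlgebra.coeff_sum,
      AddMonoidAlgebra.coeff_single, Finsupp.single_finsetSum]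
    refine Finset.sum_congr rfl fun e he => ?_
    rw [gradedEval_monomial, AddMonoidAlgebra.coeff_single]
    congr 1
    have := hdeg (castE e - castE e₀) (by rw [map_sub, hgs e he, hgs e₀ he₀, sub_self])
    rwa [map_sub, map_sub, sub_eq_zero, shiftBy_castE, shiftBy_castE] at this
  rw [hh, hθ _ (hf γ), AddMonoidAlgebra.single_zero]

end Graded

section Torsion

variable {n : ℕ}

lemma exists_nsmul_mem_of_satDegree_eq_zero (Λ : AddSubgroup ((Fin n × ℕ) →₀ ℤ))
    (hΛ : ∀ k, ∀ f ∈ Λ, shiftBy k f ∈ Λ) :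
    ∃ m : ℕ, 0 < m ∧ ∀ f, satDegree Λ f = 0 → m • f ∈ Λ := by
  classical
  obtain ⟨J, g, hg, hshift, hev⟩ := IsShiftOrder.exists_standard_basis
    (fun _ => boundKey_isShiftOrder ∅ 0) (Filter.hyperfilter ℕ) (satDegree Λ).ker
    (fun k f hf => satDegree_shiftBy_eq_zero hΛ k hf)
  obtain ⟨N, -, hN⟩ := hev.exists
  have h1 : ∀ v, ∃ m : ℕ, 0 < m ∧ m • g v ∈ Λ := fun v =>
    (satDegree_eq_zero_iff Λ (g v)).mp (hg v)
  choose M hM0 hM using h1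
  let m : ℕ := ∏ i, ∏ k ∈ Finset.range (J i + 1), M (i, k)
  have hm : ∀ v, m • g v ∈ Λ := by
    rintro ⟨i, j⟩
    have hdvd : M (i, min j (J i)) ∣ m :=
      (Finset.dvd_prod_of_mem (fun k => M (i, k))
        (Finset.mem_range.mpr (Nat.lt_succ_of_le (min_le_right j (J i))))).trans
      (Finset.dvd_prod_of_mem (fun i => ∏ k ∈ Finset.range (J i + 1), M (i, k))
        (Finset.mem_univ i))
    obtain ⟨c, hc⟩ := hdvd
    rw [hshift, ← map_nsmul]
    refine hΛ _ _ ?_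
    rw [hc, mul_comm, mul_smul]
    exact Λ.nsmul_mem (hM _) c
  refine ⟨m, Finset.prod_pos fun i _ => Finset.prod_pos fun k _ => hM0 _, fun f hf => ?_⟩
  have hfc := hN Set.univ (fun _ _ _ _ => trivial) f hf (fun _ _ => trivial)
  have hle : AddSubgroup.closure (g '' Set.univ) ≤
      Λ.comap (nsmulAddMonoidHom m) := by
    rw [AddSubgroup.closure_le]
    rintro _ ⟨v, -, rfl⟩
    exact hm v
  exact hle hfc

variable {K : Type*} [Field K] {F : Type*} [Field F] [Algebra K F] (θ : DPoly K n →ₐ[K] F)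

lemma exists_generator_of_nsmul_mem_ker (L : AddSubgroup ((Fin n × ℕ) →₀ ℤ)) {m : ℕ}
    (hm : 0 < m) (hL : ∀ f ∈ L, m • f ∈ (charHom θ).ker) :
    ∃ h ∈ L, ∀ f ∈ L, ∃ k : ℕ, f - k • h ∈ (charHom θ).ker := by
  let ψ : Multiplicative L →* Fˣ := AddMonoidHom.toMultiplicativeLeft ((charHom θ).comp L.subtype)
  have : NeZero m := ⟨hm.ne'⟩
  have hle : ψ.range ≤ rootsOfUnity m F := by
    rintro _ ⟨f, rfl⟩
    rw [mem_rootsOfUnity]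
    have := hL f.toAdd.1 f.toAdd.2
    rw [AddMonoidHom.mem_ker, map_nsmul] at this
    exact this
  have hfin : Finite ψ.range := Finite.of_injective _ (Subgroup.inclusion_injective hle)
  obtain ⟨⟨_, ⟨h, rfl⟩⟩, hgen⟩ := IsCyclic.exists_monoid_generator (α := ψ.range)
  refine ⟨h.toAdd.1, h.toAdd.2, fun f hf => ?_⟩
  obtain ⟨k, hk⟩ := hgen ⟨ψ (Multiplicative.ofAdd ⟨f, hf⟩), ⟨_, rfl⟩⟩
  refine ⟨k, ?_⟩
  have hk' := congrArg Subtype.val hk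
  rw [AddMonoidHom.mem_ker, map_sub, map_nsmul, sub_eq_zero]
  exact hk'.symm

/-- The homogenization of a univariate polynomial at a Laurent monomial. -/
noncomputable def homogenizeAt (h : (Fin n × ℕ) →₀ ℤ) (p : Polynomial K) : DPoly K n :=
  ∑ j ∈ Finset.range (p.natDegree + 1),
    MvPolynomial.monomial (j • expPos h + (p.natDegree - j) • expPos (-h)) (p.coeff j)

lemma map_homogenizeAt_eq_zero_iff {h : (Fin n × ℕ) →₀ ℤ}
    (hθ : ∀ v ∈ h.support, θ (MvPolynomial.X v) ≠ 0) (p : Polynomial K) :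
    θ (homogenizeAt h p) = 0 ↔ Polynomial.aeval (charVal θ h) p = 0 := by
  have key : θ (homogenizeAt h p) =
      charVal θ (p.natDegree • castE (expPos (-h))) * Polynomial.aeval (charVal θ h) p := by
    rw [homogenizeAt, map_sum, Polynomial.aeval_eq_sum_range, Finset.mul_sum]
    refine Finset.sum_congr rfl fun j hj => ?_
    have hjd : j ≤ p.natDegree := Nat.lt_succ_iff.mp (Finset.mem_range.mp hj)
    rw [map_monomial_eq_charVal]
    · have h1 : castE (j • expPos h + (p.natDegree - j) • expPos (-h)) =
          p.natDegree • castE (expPos (-h)) + j • h := by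
        conv_rhs => rw [← castE_expPos_sub h]
        rw [map_add, map_nsmul, map_nsmul]
        obtain ⟨d, hd⟩ := Nat.exists_eq_add_of_le hjd
        rw [hd, Nat.add_sub_cancel_left, add_smul, smul_sub]
        rw [castE_expPos_sub h]
        abel
      rw [h1, charVal_add, charVal_nsmul θ j, Algebra.smul_def]
      ring
    · intro v hv
      refine hθ v ?_
      rw [Finsupp.mem_support_iff] at hv ⊢
      intro h0
      simp [h0] at hv
  rw [key, mul_eq_zero, or_iff_right (charVal_ne_zero θ _)]

end Torsion

section Comparison

variable {K : Type*} [Field K] {n : ℕ}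

lemma map_eq_charVal_mul_aeval {F : Type*} [Field F] [Algebra K F] (θ : DPoly K n →ₐ[K] F)
    {f : DPoly K n} (hf : ∀ e ∈ f.support, ∀ v ∈ e.support, θ (MvPolynomial.X v) ≠ 0)
    (e₀ h : (Fin n × ℕ) →₀ ℤ) (k : ((Fin n × ℕ) →₀ ℕ) → ℕ)
    (hk : ∀ e ∈ f.support, castE e - e₀ - k e • h ∈ (charHom θ).ker) :
    θ f = charVal θ e₀ * Polynomial.aeval (charVal θ h)
      (∑ e ∈ f.support, Polynomial.C (f.coeff e) * Polynomial.X ^ k e) := by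
  conv_lhs => rw [f.as_sum]
  rw [map_sum, map_sum, Finset.mul_sum]
  refine Finset.sum_congr rfl fun e he => ?_
  rw [map_monomial_eq_charVal θ _ (hf e he), map_mul, map_pow, Polynomial.aeval_X,
    Polynomial.aeval_C]
  have h1 := hk e he
  rw [sub_sub, ← charVal_eq_iff, charVal_add, charVal_nsmul] at h1
  rw [h1]
  ring

lemma map_eq_zero_of_homogeneous {F F' : Type*} [Field F] [Algebra K F] [Field F'] [Algebra K F']
    (θ : DPoly K n →ₐ[K] F) (θ' : DPoly K n →ₐ[K] F')
    (hθ' : ∀ v, θ' (MvPolynomial.X v) ≠ 0) {m : ℕ} (hm : 0 < m)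
    (htors : ∀ f, satDegree (charHom θ').ker f = 0 → m • f ∈ (charHom θ').ker)
    {h : (Fin n × ℕ) →₀ ℤ}
    (hgen : ∀ f, satDegree (charHom θ').ker f = 0 → ∃ k : ℕ, f - k • h ∈ (charHom θ').ker)
    (hker : ∀ f ∈ (charHom θ').ker, (∀ u, θ (MvPolynomial.X u) = 0 → f u = 0) →
      f ∈ (charHom θ).ker)
    (hsign : ∀ f ∈ (charHom θ').ker, (∀ u, θ (MvPolynomial.X u) = 0 → 0 ≤ f u) →
      ∀ u, θ (MvPolynomial.X u) = 0 → f u = 0)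
    (hh : ∀ v ∈ h.support, θ (MvPolynomial.X v) ≠ 0)
    (hmin : Polynomial.aeval (charVal θ h) (minpoly K (charVal θ' h)) = 0)
    {f : DPoly K n} (hf : θ' f = 0)
    (hhom : ∀ e ∈ f.support, ∀ e' ∈ f.support,
      satDegree (charHom θ').ker (castE e) = satDegree (charHom θ').ker (castE e')) :
    θ f = 0 := by
  by_cases hall : ∀ e ∈ f.support, θ (MvPolynomial.monomial e (f.coeff e)) = 0
  · conv_lhs => rw [f.as_sum]
    rw [map_sum]
    exact Finset.sum_eq_zero hall
  push Not at hall
  obtain ⟨e₀, he₀, hne⟩ := hall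
  have hsupp₀ : ∀ u, θ (MvPolynomial.X u) = 0 → e₀ u = 0 := fun u hu => by
    by_contra h0
    exact hne (map_monomial_eq_zero θ _ (Finsupp.mem_support_iff.mpr h0) hu)
  have hdeg : ∀ e ∈ f.support, satDegree (charHom θ').ker (castE e - castE e₀) = 0 :=
    fun e he => by rw [map_sub, hhom e he e₀ he₀, sub_self]
  have hvan : ∀ e ∈ f.support, ∀ u, θ (MvPolynomial.X u) = 0 → e u = 0 := by
    intro e he u hu
    have h1 := hsign _ (htors _ (hdeg e he)) (fun w hw => by
      simpa [hsupp₀ w hw] using mul_nonneg (Nat.cast_nonneg (α := ℤ) m) (Nat.cast_nonneg (e w)))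
      u hu
    simpa [hsupp₀ u hu, hm.ne'] using h1
  have hex : ∀ e : (Fin n × ℕ) →₀ ℕ, ∃ k : ℕ, e ∈ f.support →
      castE e - castE e₀ - k • h ∈ (charHom θ').ker := fun e => by
    by_cases he : e ∈ f.support
    · obtain ⟨k, hk⟩ := hgen _ (hdeg e he)
      exact ⟨k, fun _ => hk⟩
    · exact ⟨0, fun h => absurd h he⟩
  choose k hk using hex
  have h1 := map_eq_charVal_mul_aeval θ' (fun _ _ v _ => hθ' v) (castE e₀) h k hk
  rw [hf, eq_comm, mul_eq_zero, or_iff_right (charVal_ne_zero θ' _)] at h1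
  rw [map_eq_charVal_mul_aeval θ (f := f)
    (fun e he v hv hv0 => Finsupp.mem_support_iff.mp hv (hvan e he v hv0)) (castE e₀) h k
    (fun e he => hker _ (hk e he) fun u hu => by
      have : h u = 0 := by
        by_contra h0
        exact hh u (Finsupp.mem_support_iff.mpr h0) hu
      simp [this, hvan e he u hu, hsupp₀ u hu])]
  obtain ⟨q, hq⟩ := minpoly.dvd K _ h1
  rw [hq, map_mul, hmin, zero_mul, mul_zero]

end Comparison

/-- The ideal of difference polynomials lying in almost all members of a family. -/
def limitIdeal {R : Type*} [CommRing R] (ω : Ultrafilter ℕ) (P : ℕ → Ideal R) : Ideal R where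
  carrier := {f | ∀ᶠ N in ω, f ∈ P N}
  zero_mem' := Filter.Eventually.of_forall fun N => (P N).zero_mem
  add_mem' ha hb := by
    filter_upwards [ha, hb] with N h1 h2 using (P N).add_mem h1 h2
  smul_mem' c f hf := by
    filter_upwards [hf] with N h using (P N).mul_mem_left c h

lemma mem_limitIdeal {R : Type*} [CommRing R] {ω : Ultrafilter ℕ} {P : ℕ → Ideal R} {f : R} :
    f ∈ limitIdeal ω P ↔ ∀ᶠ N in ω, f ∈ P N := Iff.rfl

lemma limitIdeal_isPrime {R : Type*} [CommRing R] (ω : Ultrafilter ℕ) (P : ℕ → Ideal R)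
    (hP : ∀ N, (P N).IsPrime) : (limitIdeal ω P).IsPrime where
  ne_top' := by
    rw [Ideal.ne_top_iff_one, mem_limitIdeal]
    intro h
    obtain ⟨N, hN⟩ := h.exists
    exact (Ideal.ne_top_iff_one _).mp (hP N).ne_top hN
  mem_or_mem' {a b} h := by
    rw [mem_limitIdeal, mem_limitIdeal, ← Ultrafilter.eventually_or]
    rw [mem_limitIdeal] at h
    filter_upwards [h] with N hN using (hP N).mem_or_mem hN

lemma limitIdeal_isSigmaIdeal {R : Type*} [CommRing R] {σ : R →+* R} (ω : Ultrafilter ℕ)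
    {P : ℕ → Ideal R} (hP : ∀ N, IsSigmaIdeal σ (P N)) : IsSigmaIdeal σ (limitIdeal ω P) := by
  intro a ha
  rw [mem_limitIdeal] at ha ⊢
  filter_upwards [ha] with N hN using hP N a hN

section Vanishing

variable {K : Type*} [Field K] {n : ℕ} {σK : K →+* K}

/-- The indices of the variables having a transform in `P`. -/
def vanIndices (P : Ideal (DPoly K n)) : Set (Fin n) :=
  {i | ∃ j, (MvPolynomial.X (i, j) : DPoly K n) ∈ P}

/-- The least order of a transform in `P`. -/
noncomputable def vanOrder (P : Ideal (DPoly K n)) (i : Fin n) : ℕ :=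
  sInf {j | (MvPolynomial.X (i, j) : DPoly K n) ∈ P}

lemma X_mem_iff {P : Ideal (DPoly K n)} (hP : IsSigmaIdeal (shift σK) P) (v : Fin n × ℕ) :
    (MvPolynomial.X v : DPoly K n) ∈ P ↔ v ∈ beyond (vanIndices P) (vanOrder P) := by
  obtain ⟨i, j⟩ := v
  constructor
  · intro h
    exact ⟨⟨j, h⟩, Nat.sInf_le h⟩
  · rintro ⟨h1, h2⟩
    have h3 := X_add_mem σK hP (Nat.sInf_mem h1) (j - vanOrder P i)
    change (MvPolynomial.X (i, vanOrder P i + (j - vanOrder P i)) : DPoly K n) ∈ P at h3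
    rwa [Nat.add_sub_cancel' h2] at h3

lemma lt_vanOrder {P : Ideal (DPoly K n)} (hP : IsSigmaIdeal (shift σK) P) {i : Fin n} {N : ℕ}
    (hN : (MvPolynomial.X (i, N) : DPoly K n) ∉ P) (hi : i ∈ vanIndices P) : N < vanOrder P i := by
  by_contra! h
  exact hN ((X_mem_iff hP (i, N)).mpr ⟨hi, h⟩)

lemma eq_zero_of_binom_mem {P : Ideal (DPoly K n)} [P.IsPrime] {f : (Fin n × ℕ) →₀ ℤ}
    (hf : binom K f ∈ P)
    (h0 : ∀ u, (MvPolynomial.X u : DPoly K n) ∈ P → 0 ≤ f u) (u : Fin n × ℕ)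
    (hu : (MvPolynomial.X u : DPoly K n) ∈ P) : f u = 0 := by
  by_contra hne
  have h1 := (map_monomial_one_eq_zero_iff (primePoint P) (e := expPos f)).mpr
    ⟨u, by
      have := h0 u hu
      simp only [Finsupp.mem_support_iff, expPos_apply]
      omega, (primePoint_eq_zero_iff P _).mpr hu⟩
  have h2 := (primePoint_eq_zero_iff P _).mpr hf
  rw [binom, map_sub, h1, zero_sub, neg_eq_zero, map_monomial_one_eq_zero_iff] at h2
  obtain ⟨v, hv, hv0⟩ := h2
  have := h0 v ((primePoint_eq_zero_iff P _).mp hv0)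
  simp only [Finsupp.mem_support_iff, expPos_apply, Finsupp.neg_apply] at hv
  omega

lemma binom_mem_iff {P : Ideal (DPoly K n)} [P.IsPrime] {f : (Fin n × ℕ) →₀ ℤ}
    (h : ∀ v ∈ f.support, (MvPolynomial.X v : DPoly K n) ∉ P) :
    binom K f ∈ P ↔ f ∈ (charHom (primePoint P)).ker := by
  rw [← primePoint_eq_zero_iff]
  refine map_binom_eq_zero_iff _ fun v hv => ?_
  rw [Ne, primePoint_eq_zero_iff]
  exact h v hv

lemma shiftBy_mem_ker {P : Ideal (DPoly K n)} [P.IsPrime] (hP : IsSigmaIdeal (shift σK) P)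
    (hX : ∀ v, (MvPolynomial.X v : DPoly K n) ∉ P) (k : ℕ) {f : (Fin n × ℕ) →₀ ℤ}
    (hf : f ∈ (charHom (primePoint P)).ker) : shiftBy k f ∈ (charHom (primePoint P)).ker := by
  rw [← binom_mem_iff fun v _ => hX v] at hf ⊢
  exact binom_shiftBy_mem σK hP hf k

end Vanishing

section PrimeFamily

variable {K : Type*} [Field K] {n : ℕ} {σK : K →+* K} (ω : Ultrafilter ℕ)
  (P : ℕ → Ideal (DPoly K n))

lemma X_notMem_limitIdeal (hω : (ω : Filter ℕ) ≤ Filter.atTop)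
    (hσ : ∀ N, IsSigmaIdeal (shift σK) (P N))
    (hX : ∀ N i, (MvPolynomial.X (i, N) : DPoly K n) ∉ P N) (v : Fin n × ℕ) :
    (MvPolynomial.X v : DPoly K n) ∉ limitIdeal ω P := by
  rw [mem_limitIdeal]
  intro h
  obtain ⟨N, hN, hle⟩ := (h.and (hω (Filter.eventually_ge_atTop v.2))).exists
  have h1 := X_add_mem σK (hσ N) (i := v.1) (j := v.2) hN (N - v.2)
  rw [Nat.add_sub_cancel' hle] at h1
  exact hX N v.1 h1

lemma eventually_mem_of_homogeneous (hω : (ω : Filter ℕ) ≤ Filter.atTop)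
    (hp : ∀ N, (P N).IsPrime) (hσ : ∀ N, IsSigmaIdeal (shift σK) (P N))
    (hX : ∀ N i, (MvPolynomial.X (i, N) : DPoly K n) ∉ P N) [hQ : (limitIdeal ω P).IsPrime] :
    ∀ᶠ N in ω, ∀ f ∈ limitIdeal ω P,
      (∀ e ∈ f.support, ∀ e' ∈ f.support,
        satDegree (charHom (primePoint (limitIdeal ω P))).ker (castE e) =
          satDegree (charHom (primePoint (limitIdeal ω P))).ker (castE e')) →
      f ∈ P N := by
  classical
  have hσQ := limitIdeal_isSigmaIdeal ω hσ
  have hXQ := X_notMem_limitIdeal ω P hω hσ hX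
  have hshiftΛ : ∀ k, ∀ f ∈ (charHom (primePoint (limitIdeal ω P))).ker,
      shiftBy k f ∈ (charHom (primePoint (limitIdeal ω P))).ker :=
    fun k f hf => shiftBy_mem_ker hσQ hXQ k hf
  have hbinom : ∀ f ∈ (charHom (primePoint (limitIdeal ω P))).ker,
      ∀ᶠ N in ω, binom K f ∈ P N := fun f hf =>
    mem_limitIdeal.mp ((binom_mem_iff fun v _ => hXQ v).mpr hf)
  have hθQ : ∀ v, primePoint (limitIdeal ω P) (MvPolynomial.X v) ≠ 0 := fun v => by
    rw [Ne, primePoint_eq_zero_iff]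
    exact hXQ v
  obtain ⟨m, hm, htors⟩ := exists_nsmul_mem_of_satDegree_eq_zero _ hshiftΛ
  obtain ⟨h, hhL, hgen⟩ := exists_generator_of_nsmul_mem_ker (primePoint (limitIdeal ω P))
    (satDegree (charHom (primePoint (limitIdeal ω P))).ker).ker hm htors
  obtain ⟨J, g, hgΛ, hshift, hstd⟩ := IsShiftOrder.exists_standard_basis
    (fun N => boundKey_isShiftOrder (vanIndices (P N)) (vanOrder (P N))) ω _ hshiftΛ
  have hsign := eventually_sign_condition ω hω
    (fun N i hi => lt_vanOrder (hσ N) (hX N i) hi) hgΛ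
    (fun i j k hj => by
      rw [hshift, hshift i j, shiftBy_shiftBy, min_eq_right hj,
        min_eq_right (hj.trans (Nat.le_add_right j k))]
      congr 2
      omega) hstd
    (fun f hf => by
      filter_upwards [hbinom f hf] with N hN k hpos u hu
      have := hp N
      exact eq_zero_of_binom_mem (binom_shiftBy_mem σK (hσ N) hN k)
        (fun w hw => hpos w ((X_mem_iff (hσ N) w).mp hw)) u ((X_mem_iff (hσ N) u).mpr hu))
  have hfin : ∀ᶠ N in ω, ∀ i, ∀ k ∈ Finset.range (J i + 1), binom K (g (i, k)) ∈ P N := by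
    refine Filter.eventually_all.mpr fun i => ?_
    rw [Filter.eventually_all_finset]
    exact fun k _ => hbinom _ (hgΛ _)
  have hmin : homogenizeAt h (minpoly K (charVal (primePoint (limitIdeal ω P)) h)) ∈
      limitIdeal ω P := by
    rw [← primePoint_eq_zero_iff, map_homogenizeAt_eq_zero_iff _ fun v _ => hθQ v]
    exact minpoly.aeval _ _
  have hsupp : ∀ᶠ N in ω, ∀ v ∈ h.support, (MvPolynomial.X v : DPoly K n) ∉ P N := by
    rw [Filter.eventually_all_finset]
    exact fun v _ => Ultrafilter.eventually_not.mpr (hXQ v)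
  filter_upwards [hstd, hsign, hfin, mem_limitIdeal.mp hmin, hsupp] with N hstdN hsignN hfinN
    hminN hsuppN f hf hhom
  have := hp N
  have hvan : ∀ u, primePoint (P N) (MvPolynomial.X u) = 0 ↔
      u ∈ beyond (vanIndices (P N)) (vanOrder (P N)) := fun u => by
    rw [primePoint_eq_zero_iff, X_mem_iff (hσ N)]
  have hhN : ∀ v ∈ h.support, primePoint (P N) (MvPolynomial.X v) ≠ 0 := fun v hv => by
    rw [Ne, primePoint_eq_zero_iff]
    exact hsuppN v hv
  rw [← primePoint_eq_zero_iff]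
  refine map_eq_zero_of_homogeneous _ (primePoint (limitIdeal ω P)) hθQ hm htors hgen ?_ ?_ hhN
    ?_ ((primePoint_eq_zero_iff _ _).mpr hf) hhom
  · intro x hx hx0
    have hlow : ∀ u v, boundKey (vanIndices (P N)) (vanOrder (P N)) u ≤
        boundKey (vanIndices (P N)) (vanOrder (P N)) v →
        v ∈ (beyond (vanIndices (P N)) (vanOrder (P N)))ᶜ →
        u ∈ (beyond (vanIndices (P N)) (vanOrder (P N)))ᶜ := by
      intro u v huv hv hu
      have := mem_of_boundKey_le (i := u.1) (j := u.2) (i' := v.1) (j' := v.2) huv hu.1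
      exact hv ⟨this.1, by have := hu.2; omega⟩
    have hmem := hstdN.2 _ hlow x hx fun u hu hub =>
      Finsupp.mem_support_iff.mp hu (hx0 u ((hvan u).mpr hub))
    refine (AddSubgroup.closure_le _).mpr ?_ hmem
    rintro _ ⟨⟨i, j⟩, hv, rfl⟩
    refine (binom_mem_iff fun u hu hu0 => ?_).mp ?_
    · exact hlow u (i, j) (hstdN.1 _ u hu) hv ((X_mem_iff (hσ N) u).mp hu0)
    · rw [hshift]
      exact binom_shiftBy_mem σK (hσ N)
        (hfinN i _ (Finset.mem_range.mpr (Nat.lt_succ_of_le (min_le_right _ _)))) _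
  · intro x hx hpos u hu
    exact hsignN x hx (fun w hw => hpos w ((hvan w).mpr hw)) u ((hvan u).mp hu)
  · rwa [← map_homogenizeAt_eq_zero_iff _ hhN, primePoint_eq_zero_iff]

lemma eventually_mem_of_mem_colonM (hω : (ω : Filter ℕ) ≤ Filter.atTop)
    (hp : ∀ N, (P N).IsPrime) (hσ : ∀ N, IsSigmaIdeal (shift σK) (P N))
    (hX : ∀ N i, (MvPolynomial.X (i, N) : DPoly K n) ∉ P N) {I : Ideal (DPoly K n)}
    (hI : IsPureBinomialSigmaIdeal σK I) (hIP : ∀ N, I ≤ P N) :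
    ∀ᶠ N in ω, ∀ f ∈ colonM (rwmClosure (shift σK) (I : Set (DPoly K n))), f ∈ P N := by
  have hQ := limitIdeal_isPrime ω P hp
  have hσQ := limitIdeal_isSigmaIdeal ω hσ
  have hXQ := X_notMem_limitIdeal ω P hω hσ hX
  have hIQ : I ≤ limitIdeal ω P := fun x hx =>
    mem_limitIdeal.mpr (Filter.Eventually.of_forall fun N => hIP N hx)
  set θ := primePoint (limitIdeal ω P) with hθ
  set deg := satDegree (charHom θ).ker with hdeg
  have hθX : ∀ v, θ (MvPolynomial.X v) ≠ 0 := fun v => by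
    rw [hθ, Ne, primePoint_eq_zero_iff]
    exact hXQ v
  have hQ' : (RingHom.ker (gradedEval θ deg)).IsPrime := RingHom.ker_isPrime _
  have hσQ' : IsSigmaIdeal (shift σK) (RingHom.ker (gradedEval θ deg)) := by
    intro f hf
    refine gradedEval_shift_eq_zero θ deg σK (fun x hx => satDegree_shiftBy_eq_zero
      (fun k f hf => shiftBy_mem_ker hσQ hXQ k hf) 1 hx) (fun f hf => ?_) hf
    rw [hθ, primePoint_eq_zero_iff] at hf ⊢
    exact hσQ f hf
  have hXQ' : ∀ v, (MvPolynomial.X v : DPoly K n) ∉ RingHom.ker (gradedEval θ deg) := by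
    intro v hv
    rw [RingHom.mem_ker, gradedEval, MvPolynomial.aeval_X, AddMonoidAlgebra.single_eq_zero] at hv
    exact hθX v hv
  have hIQ' : I ≤ RingHom.ker (gradedEval θ deg) := by
    obtain ⟨S, hS, hIS⟩ := hI
    rw [hIS]
    refine sigmaIdealGen_le hσQ' fun p hpS => ?_
    have hpQ : θ p = 0 := (primePoint_eq_zero_iff _ _).mpr
      (hIQ (hIS ▸ subset_sigmaIdealGen S hpS))
    obtain ⟨f, g, rfl⟩ := hS p hpS
    obtain ⟨e, he⟩ := exists_monom_eq σK f
    obtain ⟨e', he'⟩ := exists_monom_eq σK g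
    rw [he, he', map_sub, sub_eq_zero] at hpQ
    have h1 : deg (castE e) = deg (castE e') := by
      rw [← sub_eq_zero, ← map_sub, hdeg, satDegree_eq_zero_iff]
      refine ⟨1, one_pos, ?_⟩
      rw [one_smul, ← charVal_eq_iff]
      rwa [map_monomial_eq_charVal θ 1 fun v _ => hθX v,
        map_monomial_eq_charVal θ 1 fun v _ => hθX v, map_one, one_mul, one_mul] at hpQ
    rw [SetLike.mem_coe, RingHom.mem_ker, he, he', map_sub, gradedEval_monomial,
      gradedEval_monomial, h1, hpQ, sub_self]
  filter_upwards [eventually_mem_of_homogeneous ω P hω hp hσ hX] with N hN f hf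
  obtain ⟨M, hM, hMf⟩ := hf
  have hfQ' := ((hQ'.mem_or_mem (rwmClosure_le_of_isPrime hσQ' hIQ' hMf)).resolve_left
    (notMem_of_mem_mSet hXQ' hM))
  rw [RingHom.mem_ker, gradedEval_eq_zero_iff] at hfQ'
  obtain ⟨s, hs⟩ := exists_sum_gradedComponent deg f
  rw [hs]
  refine (P N).sum_mem fun γ _ => hN _ ((primePoint_eq_zero_iff _ _).mp (hfQ' γ)) ?_
  intro e he e' he'
  rw [← hθ, ← hdeg, degree_of_mem_support_gradedComponent deg he,
    degree_of_mem_support_gradedComponent deg he']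

end PrimeFamily

/-- For a pure binomial σ-ideal `I`,
`⟨I⟩_r = (⟨I⟩_r : 𝔪) ∩ ⟨I, y_{p_1}^{x^{a_1}}⟩_r ∩ ⋯ ∩ ⟨I, y_{p_l}^{x^{a_l}}⟩_r`. -/
theorem stmt4 {K : Type*} [Field K] [CharZero K] {n : ℕ} (σK : K →+* K)
    (I : Ideal (DPoly K n)) (hI : IsPureBinomialSigmaIdeal σK I) :
    ∃ (l : ℕ) (p : Fin l → Fin n) (a : Fin l → ℕ),
      (rwmClosure (shift σK) (I : Set (DPoly K n)) : Set (DPoly K n)) =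
        colonM (rwmClosure (shift σK) (I : Set (DPoly K n))) ∩
          ⋂ k : Fin l, (rwmClosure (shift σK)
            ((I : Set (DPoly K n)) ∪ {varPow σK (p k) (a k)}) : Set (DPoly K n)) := by
  by_contra hne
  have key : ∀ N : ℕ, ∃ (P : Ideal (DPoly K n)) (f : DPoly K n), P.IsPrime ∧
      IsSigmaIdeal (shift σK) P ∧ I ≤ P ∧
      (∀ i, (MvPolynomial.X (i, N) : DPoly K n) ∉ P) ∧
      f ∈ colonM (rwmClosure (shift σK) (I : Set (DPoly K n))) ∧ f ∉ P := by
    intro N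
    by_contra hno
    refine hne ⟨n, id, fun _ => N, Set.Subset.antisymm (fun f hf => ⟨?_, ?_⟩) ?_⟩
    · exact ⟨1, Submonoid.one_mem _, by rwa [one_mul]⟩
    · exact Set.mem_iInter.mpr fun k => rwmClosure_mono Set.subset_union_left hf
    · rintro f ⟨hf1, hf2⟩
      by_contra hf
      obtain ⟨P, hP, hσP, hle, hfP⟩ := exists_isPrime_notMem_of_notMem_rwmClosure hf
      have hIP : (I : Set (DPoly K n)) ⊆ P := (subset_rwmClosure _).trans hle
      refine hno ⟨P, f, hP, hσP, hIP, fun i hi => hfP ?_, hf1, hfP⟩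
      refine rwmClosure_le_of_isPrime hσP (Set.union_subset hIP ?_) (Set.mem_iInter.mp hf2 i)
      rwa [Set.singleton_subset_iff, varPow_eq_X]
  choose P f hp hσ hIP hX hf hfP using key
  have hω : ((Filter.hyperfilter ℕ : Ultrafilter ℕ) : Filter ℕ) ≤ Filter.atTop := by
    rw [← Nat.cofinite_eq_atTop]
    exact Filter.hyperfilter_le_cofinite
  obtain ⟨N, hN⟩ := (eventually_mem_of_mem_colonM _ P hω hp hσ hX hI hIP).exists
  exact hfP N (hN _ (hf N))
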